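/- arXiv:1709.03936 — 2 statements merged into one kernel-verified Lean document; each statement's English description precedes it below -/
import Mathlib

section
/- Let n ≥ d+2 and let p be a generic configuration of n points in ℝ^d. Let v = ⟨G, p⟩², where G is an edge measurement ensemble consisting of exactly the N = C(n,2) edges of K_n in some order. Suppose there is a configuration q of n points in ℝ^d and an edge measurement ensemble H, also consisting of exactly the N edges of K_n in some (possibly different) order, such that v = ⟨H, q⟩². Then there is a vertex relabeling of q such that, up to congruence, q = p, and moreover, under this vertex relabeling, G = H. -/
/-- Euclidean distance between two points of ℝ^d. -/
noncomputable def eudist {d : ℕ} (x y : Fin d → ℝ) : ℝ :=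
  Real.sqrt (∑ k, (x k - y k) ^ 2)

/-- Squared Euclidean length along an edge (an unordered pair of vertices) of a
configuration. -/
noncomputable def sqLenR {n d : ℕ} (p : Fin n → Fin d → ℝ) : Sym2 (Fin n) → ℝ :=
  Sym2.lift ⟨fun i j => ∑ k, (p i k - p j k) ^ 2,
    fun i j => Finset.sum_congr rfl fun k _ => by ring⟩

/-- Euclidean length along an edge of a configuration. -/
noncomputable def lenR {n d : ℕ} (p : Fin n → Fin d → ℝ) (e : Sym2 (Fin n)) : ℝ :=
  Real.sqrt (sqLenR p e)

/-- A generic configuration of `n` points in ℝ^d: its `d·n` coordinates satisfy no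
nontrivial polynomial equation with rational coefficients. -/
def GenericConfig {n d : ℕ} (p : Fin n → Fin d → ℝ) : Prop :=
  ∀ f : MvPolynomial (Fin n × Fin d) ℚ, f ≠ 0 →
    MvPolynomial.aeval (fun ik : Fin n × Fin d => p ik.1 ik.2) f ≠ 0

/-- A congruence of ℝ^d: a distance-preserving bijection. -/
def IsCongruence {d : ℕ} (f : (Fin d → ℝ) → (Fin d → ℝ)) : Prop :=
  Function.Bijective f ∧ ∀ x y, eudist (f x) (f y) = eudist x y

/-- A similarity of ℝ^d: a bijection scaling all distances by a fixed positive
ratio (equivalently, the composition of a positive scaling and a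
distance-preserving bijection). -/
def IsSimilarity {d : ℕ} (f : (Fin d → ℝ) → (Fin d → ℝ)) : Prop :=
  Function.Bijective f ∧ ∃ r : ℝ, 0 < r ∧ ∀ x y, eudist (f x) (f y) = r * eudist x y

/-- base-vertex Gram matrix of edge weights -/
def gramMx {R : Type*} [CommRing R] {m : ℕ} (E : Sym2 (Fin (m+1)) → R) : Matrix (Fin m) (Fin m) R :=
  Matrix.of fun i j => E s(0, i.succ) + E s(0, j.succ) - E s(i.succ, j.succ)

theorem gramMx_symm {R : Type*} [CommRing R] {m : ℕ} (E : Sym2 (Fin (m+1)) → R) :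
    (gramMx E).transpose = gramMx E := by
  ext i j
  simp only [gramMx, Matrix.transpose_apply, Matrix.of_apply]
  rw [Sym2.eq_swap (a := i.succ)]
  ring

theorem gram_det_zero {m d : ℕ} (q : Fin (m+1) → Fin d → ℝ) (W : Matrix (Fin (d+1)) (Fin m) ℝ) :
    (W * gramMx (sqLenR q) * W.transpose).det = 0 := by
  set Y : Matrix (Fin m) (Fin d) ℝ := Matrix.of fun i k => q i.succ k - q 0 k with hY
  have h1 : gramMx (sqLenR q) = Y * ((2:ℝ) • Y.transpose) := by
    ext i j
    simp only [gramMx, sqLenR, Matrix.of_apply, Sym2.lift_mk, Matrix.mul_apply, Matrix.smul_apply,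
      Matrix.transpose_apply, hY, smul_eq_mul, ← Finset.sum_add_distrib, ← Finset.sum_sub_distrib]
    refine Finset.sum_congr rfl fun k _ => ?_
    ring
  by_contra h
  have hr := Matrix.rank_of_isUnit _ ((Matrix.isUnit_iff_isUnit_det _).2 (isUnit_iff_ne_zero.2 h))
  rw [h1] at hr
  have h2 : W * (Y * ((2:ℝ) • Y.transpose)) * W.transpose
     = (W * Y) * (((2:ℝ) • Y.transpose) * W.transpose) := by simp only [Matrix.mul_assoc]
  rw [h2] at hr
  have h3 := Matrix.rank_mul_le_left (W * Y) (((2:ℝ) • Y.transpose) * W.transpose)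
  have h4 := Matrix.rank_le_width (W * Y)
  rw [Fintype.card_fin] at hr
  omega

/-- polynomial squared length -/
noncomputable def sqLenP {n d : ℕ} : Sym2 (Fin n) → MvPolynomial (Fin n × Fin d) ℚ :=
  Sym2.lift ⟨fun i j => ∑ k, (MvPolynomial.X (i,k) - MvPolynomial.X (j,k)) ^ 2,
    fun i j => Finset.sum_congr rfl fun k _ => by ring⟩

theorem aeval_sqLenP {n d : ℕ} (x : Fin n → Fin d → ℝ) (e : Sym2 (Fin n)) :
    MvPolynomial.aeval (fun ik : Fin n × Fin d => x ik.1 ik.2) (sqLenP e) = sqLenR x e := by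
  induction e using Sym2.ind with
  | _ i j => simp [sqLenP, sqLenR]

theorem transfer_rat {m d k : ℕ} (p : Fin (m+1) → Fin d → ℝ) (hp : GenericConfig p)
    (φ : Sym2 (Fin (m+1)) → Sym2 (Fin (m+1))) (W : Matrix (Fin k) (Fin m) ℚ)
    (h : (W.map (fun a : ℚ => (a:ℝ)) * gramMx (sqLenR p ∘ φ) *
      (W.map (fun a : ℚ => (a:ℝ))).transpose).det = 0) (x : Fin (m+1) → Fin d → ℝ) :
    (W.map (fun a : ℚ => (a:ℝ)) * gramMx (sqLenR x ∘ φ) *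
      (W.map (fun a : ℚ => (a:ℝ))).transpose).det = 0 := by
  set WP : Matrix (Fin k) (Fin m) (MvPolynomial (Fin (m+1) × Fin d) ℚ) :=
    Matrix.of fun i j => MvPolynomial.C (W i j) with hWP
  set GP : Matrix (Fin m) (Fin m) (MvPolynomial (Fin (m+1) × Fin d) ℚ) := gramMx (sqLenP ∘ φ) with hGP
  set F : MvPolynomial (Fin (m+1) × Fin d) ℚ :=
    (WP * GP * WP.transpose).det with hF
  have key : ∀ y : Fin (m+1) → Fin d → ℝ,
      MvPolynomial.aeval (fun ik : Fin (m+1) × Fin d => y ik.1 ik.2) F =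
      (W.map (fun a : ℚ => (a:ℝ)) * gramMx (sqLenR y ∘ φ) *
      (W.map (fun a : ℚ => (a:ℝ))).transpose).det := by
    intro y
    rw [hF, AlgHom.map_det]
    congr 1
    ext a b
    simp [hWP, hGP, Matrix.mul_apply, gramMx, aeval_sqLenP]
  have hF0 : F = 0 := by
    by_contra hne
    exact hp F hne (by rw [key, h])
  rw [← key, hF0, map_zero]

theorem transfer_real {m d : ℕ} (p q : Fin (m+1) → Fin d → ℝ) (hp : GenericConfig p)
    (φ : Sym2 (Fin (m+1)) → Sym2 (Fin (m+1))) (hq : sqLenR q = sqLenR p ∘ φ)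
    (x : Fin (m+1) → Fin d → ℝ) (W : Matrix (Fin (d+1)) (Fin m) ℝ) :
    (W * gramMx (sqLenR x ∘ φ) * W.transpose).det = 0 := by
  have hdense : DenseRange (fun W : Fin (d+1) → Fin m → ℚ => fun a b => ((W a b : ℚ) : ℝ)) :=
    DenseRange.piMap fun _ => DenseRange.piMap fun _ => Rat.denseRange_cast
  have hc : Continuous (fun W : Fin (d+1) → Fin m → ℝ =>
      ((Matrix.of W) * gramMx (sqLenR x ∘ φ) * (Matrix.of W).transpose).det) := by
    apply Continuous.matrix_det
    apply Continuous.matrix_mul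
    · exact Continuous.matrix_mul continuous_id continuous_const
    · exact Continuous.matrix_transpose continuous_id
  have := hdense.equalizer hc (continuous_const (y := (0:ℝ))) (by
    funext W
    exact transfer_rat p hp φ (Matrix.of W) (by rw [← hq]; exact gram_det_zero q _) x)
  exact congrFun this W

theorem grow {m r : ℕ} (M : Matrix (Fin m) (Fin m) ℝ) (hM : M.transpose = M)
    (W : Matrix (Fin r) (Fin m) ℝ) (hW : (W * M * W.transpose).det ≠ 0) (hr : r < m)
    {ι : Type*} (N : ι → Matrix (Fin m) (Fin m) ℝ)
    (hN : ∀ u : Fin m → ℝ, u ≠ 0 → ∃ y, u ⬝ᵥ (N y).mulVec u ≠ 0) :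
    ∃ y, ∃ s : ℝ, ∃ W' : Matrix (Fin (r+1)) (Fin m) ℝ,
      (W' * (M + s^2 • N y) * W'.transpose).det ≠ 0 := by
  obtain ⟨u, hu0, hu⟩ : ∃ u : Fin m → ℝ, u ≠ 0 ∧ (W * M).mulVec u = 0 := by
    have := LinearMap.ker_ne_bot_of_finrank_lt (f := (W * M).mulVecLin) (by simpa using hr)
    obtain ⟨u, hu, hu0⟩ := Submodule.exists_mem_ne_zero_of_ne_bot this
    exact ⟨u, hu0, by simpa using hu⟩
  obtain ⟨y, hy⟩ := hN u hu0
  set U : Matrix (Fin 1) (Fin m) ℝ := Matrix.of fun _ => u with hU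
  have hb : W * M * U.transpose = 0 := by
    ext i j
    exact congrFun hu i
  have hb' : U * M * W.transpose = 0 := by
    have := congrArg Matrix.transpose hb
    simpa [Matrix.transpose_mul, hM, Matrix.mul_assoc] using this
  have hc : (U * N y * U.transpose).det ≠ 0 := by
    convert hy using 1
    rw [Matrix.det_fin_one, Matrix.mul_assoc]
    rfl
  have red : ∀ s : ℝ, ((Matrix.fromRows W U) * (M + s^2 • N y) * (Matrix.fromRows W U).transpose).det ≠ 0 →
    ∃ W' : Matrix (Fin (r+1)) (Fin m) ℝ,
      (W' * (M + s^2 • N y) * W'.transpose).det ≠ 0 := by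
    intro s hs
    refine ⟨(Matrix.fromRows W U).submatrix finSumFinEquiv.symm id, ?_⟩
    convert hs using 1
    rw [← Matrix.det_submatrix_equiv_self finSumFinEquiv.symm]
    congr 1
  have blk : ∀ s : ℝ, (Matrix.fromRows W U) * (M + s^2 • N y) * (Matrix.fromRows W U).transpose =
     Matrix.fromBlocks (W * M * W.transpose + s^2 • (W * N y * W.transpose))
       (s^2 • (W * N y * U.transpose)) (s^2 • (U * N y * W.transpose))
       (U * M * U.transpose + s^2 • (U * N y * U.transpose)) := by
    intro s
    rw [Matrix.transpose_fromRows, Matrix.fromRows_mul, Matrix.fromRows_mul_fromCols]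
    simp only [Matrix.mul_add, Matrix.add_mul, Matrix.mul_smul, Matrix.smul_mul, hb, hb', zero_add]
  refine ⟨y, ?_⟩
  by_cases ha : (U * M * U.transpose).det = 0
  · have ha' : U * M * U.transpose = 0 := by
      ext i j
      rw [Matrix.det_fin_one] at ha
      fin_cases i; fin_cases j; simpa using ha
    have hcont : Continuous (fun s : ℝ => (Matrix.fromBlocks (W * M * W.transpose + s^2 • (W * N y * W.transpose))
       (s^2 • (W * N y * U.transpose)) (U * N y * W.transpose) (U * N y * U.transpose)).det) := by
      apply Continuous.matrix_det
      apply Continuous.matrix_fromBlocks <;> fun_prop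
    have h0 := hcont.continuousAt.eventually_ne (x := 0) (y := (0:ℝ)) (by
      simp [hW]; simpa using hc)
    obtain ⟨s, hs, hs0⟩ := ((h0.filter_mono nhdsWithin_le_nhds).and
      (self_mem_nhdsWithin : {x : ℝ | x ≠ 0} ∈ nhdsWithin 0 {0}ᶜ)).exists
    refine ⟨s, red s ?_⟩
    have : (Matrix.fromRows W U) * (M + s^2 • N y) * (Matrix.fromRows W U).transpose =
       Matrix.fromBlocks 1 0 0 (s^2 • 1) * Matrix.fromBlocks (W * M * W.transpose + s^2 • (W * N y * W.transpose))
       (s^2 • (W * N y * U.transpose)) (U * N y * W.transpose) (U * N y * U.transpose) := by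
      rw [blk, Matrix.fromBlocks_multiply, ha']
      simp
    rw [this, Matrix.det_mul]
    refine mul_ne_zero ?_ hs
    simpa using hs0
  · refine ⟨0, red 0 ?_⟩
    rw [blk]
    simp [hW]
    simpa using ha

theorem gramMx_add {m : ℕ} (E F : Sym2 (Fin (m+1)) → ℝ) : gramMx (E + F) = gramMx E + gramMx F := by
  ext i j; simp [gramMx]; ring

theorem gramMx_smul {m : ℕ} (c : ℝ) (F : Sym2 (Fin (m+1)) → ℝ) : gramMx (c • F) = c • gramMx F := by
  ext i j; simp [gramMx]; ring

/-- one-dimensional indicator configuration -/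
def ind {n : ℕ} (i : Fin n) : Fin n → Fin 1 → ℝ := fun a _ => if a = i then 1 else 0

theorem ind_polar {n : ℕ} (i j : Fin n) (hij : i ≠ j) :
    (fun e => if s(i,j) = e then (1:ℝ) else 0) =
      (1/2 : ℝ) • (sqLenR (ind i) + sqLenR (ind j) + (-1 : ℝ) • sqLenR (ind i + ind j)) := by
  funext e
  induction e using Sym2.ind with
  | _ a b =>
    simp only [Pi.smul_apply, Pi.add_apply, sqLenR, Sym2.lift_mk, ind, Sym2.eq_iff, smul_eq_mul,
      Finset.univ_unique, Finset.sum_singleton]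
    by_cases h1 : a = i <;> by_cases h2 : a = j <;> by_cases h3 : b = i <;> by_cases h4 : b = j <;>
      grind

theorem span_lemma {m : ℕ} (φ : Equiv.Perm (Sym2 (Fin (m+1))))
    (hφ : ∀ e, (φ e).IsDiag ↔ e.IsDiag) (u : Fin m → ℝ) (hu : u ≠ 0) :
    ∃ y : Fin (m+1) → Fin 1 → ℝ, u ⬝ᵥ (gramMx (sqLenR y ∘ φ)).mulVec u ≠ 0 := by
  by_contra hcon
  push Not at hcon
  let L : (Sym2 (Fin (m+1)) → ℝ) →ₗ[ℝ] ℝ :=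
    { toFun := fun E => u ⬝ᵥ (gramMx (E ∘ φ)).mulVec u
      map_add' := fun E F => by
        have : (E + F) ∘ φ = E ∘ φ + F ∘ φ := rfl
        rw [this, gramMx_add, Matrix.add_mulVec, dotProduct_add]
      map_smul' := fun c F => by
        have : (c • F) ∘ φ = c • (F ∘ φ) := rfl
        rw [this, gramMx_smul, Matrix.smul_mulVec, dotProduct_smul]; rfl }
  have hL : ∀ y : Fin (m+1) → Fin 1 → ℝ, L (sqLenR y) = 0 := hcon
  have hL1 : ∀ e : Sym2 (Fin (m+1)), ¬ e.IsDiag → L (fun e' => if e = e' then 1 else 0) = 0 := by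
    intro e he
    induction e using Sym2.ind with
    | _ i j =>
      rw [ind_polar i j (by simpa using he)]
      simp only [map_smul, map_add, hL]
      simp
  have hL2 : ∀ E : Sym2 (Fin (m+1)) → ℝ, (∀ e, e.IsDiag → E e = 0) → L E = 0 := by
    intro E hE
    rw [LinearMap.pi_apply_eq_sum_univ]
    refine Finset.sum_eq_zero fun e _ => ?_
    by_cases he : e.IsDiag
    · rw [hE e he, zero_smul]
    · rw [hL1 e he, smul_zero]
  obtain ⟨i, hi⟩ := Function.ne_iff.1 hu
  have h3 := hL2 (sqLenR (ind i.succ) ∘ φ.symm) (by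
    intro e he
    have : (φ.symm e).IsDiag := by rw [← hφ]; simpa using he
    simp only [Function.comp]
    generalize φ.symm e = e' at this
    induction e' using Sym2.ind with
    | _ a b =>
      simp at this
      simp [sqLenR, this])
  have h4 : L (sqLenR (ind i.succ) ∘ φ.symm) = 2 * (u i * u i) := by
    change u ⬝ᵥ (gramMx ((sqLenR (ind i.succ) ∘ φ.symm) ∘ φ)).mulVec u = _
    have : (sqLenR (ind i.succ) ∘ φ.symm) ∘ φ = sqLenR (ind i.succ) := by
      funext e; simp
    rw [this]
    have hg : gramMx (sqLenR (ind i.succ)) = Matrix.of fun a b : Fin m =>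
        (if a = i then (1:ℝ) else 0) * (if b = i then 2 else 0) := by
      ext a b
      simp only [gramMx, sqLenR, ind, Matrix.of_apply, Sym2.lift_mk, Finset.univ_unique,
        Finset.sum_singleton, Fin.succ_inj, (Fin.succ_ne_zero i).symm, if_false]
      split_ifs <;> norm_num
    rw [hg]
    simp [dotProduct, Matrix.mulVec]
    ring
  rw [h4] at h3
  have : u i ≠ 0 := hi
  have := mul_self_pos.2 this
  linarith

theorem sqLenR_snoc {n k : ℕ} (x : Fin n → Fin k → ℝ) (y : Fin n → Fin 1 → ℝ) (s : ℝ) :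
    sqLenR (fun i => (Fin.snoc (x i) (s * y i 0) : Fin (k+1) → ℝ)) = sqLenR x + s^2 • sqLenR y := by
  funext e
  induction e using Sym2.ind with
  | _ a b =>
    simp [sqLenR, Fin.sum_univ_castSucc]
    ring

theorem rank_one {m d : ℕ} (hd : 1 ≤ d) (hm : d < m) (φ : Equiv.Perm (Sym2 (Fin (m+1))))
    (hφ : ∀ e, (φ e).IsDiag ↔ e.IsDiag)
    (ht : ∀ (x : Fin (m+1) → Fin d → ℝ) (W : Matrix (Fin (d+1)) (Fin m) ℝ),
      (W * gramMx (sqLenR x ∘ φ) * W.transpose).det = 0)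
    (y : Fin (m+1) → Fin 1 → ℝ) (W : Matrix (Fin 2) (Fin m) ℝ) :
      (W * gramMx (sqLenR y ∘ φ) * W.transpose).det = 0 := by
  by_contra hcon
  have key : ∀ k, 1 ≤ k → k ≤ d → ∃ (x : Fin (m+1) → Fin k → ℝ) (W : Matrix (Fin (k+1)) (Fin m) ℝ),
      (W * gramMx (sqLenR x ∘ φ) * W.transpose).det ≠ 0 := by
    intro k hk
    induction k, hk using Nat.le_induction with
    | base => exact fun _ => ⟨y, W, hcon⟩
    | succ k hk ih =>
      intro hkd
      obtain ⟨x, W, hW⟩ := ih (by omega)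
      obtain ⟨z, s, W', hW'⟩ := grow _ (gramMx_symm _) W hW (by omega)
        (fun y : Fin (m+1) → Fin 1 → ℝ => gramMx (sqLenR y ∘ φ)) (span_lemma φ hφ)
      refine ⟨fun i => (Fin.snoc (x i) (s * z i 0) : Fin (k+1) → ℝ), W', ?_⟩
      rw [sqLenR_snoc]
      have : (sqLenR x + s^2 • sqLenR z) ∘ φ = sqLenR x ∘ φ + s^2 • (sqLenR z ∘ φ) := rfl
      rwa [this, gramMx_add, gramMx_smul]
  obtain ⟨x, W, h⟩ := key d hd le_rfl
  exact h (ht x W)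

theorem minor {m : ℕ} (M : Matrix (Fin m) (Fin m) ℝ)
    (h : ∀ W : Matrix (Fin 2) (Fin m) ℝ, (W * M * W.transpose).det = 0) (a b : Fin m) :
    M a a * M b b = M a b * M b a := by
  set W : Matrix (Fin 2) (Fin m) ℝ := Matrix.of fun r => Pi.single (![a,b] r) 1 with hW
  have h1 := h W
  have h2 : W * M * W.transpose = M.submatrix ![a,b] ![a,b] := by
    ext r t
    simp [hW, Matrix.mul_apply, Pi.single_apply]
  rw [h2, Matrix.det_fin_two] at h1
  simp at h1
  linarith

/-- the cut of a vertex set -/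
def cutSet {n : ℕ} (S : Finset (Fin n)) : Finset (Sym2 (Fin n)) :=
  (S ×ˢ Sᶜ).image fun x => s(x.1, x.2)

theorem mem_cutSet {n : ℕ} (S : Finset (Fin n)) (a b : Fin n) :
    s(a,b) ∈ cutSet S ↔ (a ∈ S ∧ b ∉ S) ∨ (b ∈ S ∧ a ∉ S) := by
  simp only [cutSet, Finset.mem_image, Finset.mem_product, Finset.mem_compl, Prod.exists, Sym2.eq_iff]
  grind

theorem card_cutSet {n : ℕ} (S : Finset (Fin n)) : (cutSet S).card = S.card * (n - S.card) := by
  rw [cutSet, Finset.card_image_of_injOn, Finset.card_product, Finset.card_compl, Fintype.card_fin]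
  rintro ⟨a, b⟩ h ⟨a', b'⟩ h' heq
  simp only [Finset.coe_product, Set.mem_prod, Finset.mem_coe, Finset.mem_compl, Sym2.eq_iff] at h h' heq
  grind

theorem cutSet_compl {n : ℕ} (S : Finset (Fin n)) : cutSet Sᶜ = cutSet S := by
  ext e
  induction e using Sym2.ind with
  | _ a b => simp only [mem_cutSet, Finset.mem_compl]; tauto

theorem sqLen_ind {n : ℕ} (i : Fin n) (e : Sym2 (Fin n)) :
    sqLenR (ind i) e = if e ∈ cutSet {i} then 1 else 0 := by
  induction e using Sym2.ind with
  | _ a b =>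
    simp only [mem_cutSet, sqLenR, ind, Sym2.lift_mk, Finset.univ_unique, Finset.sum_singleton, Finset.mem_singleton]
    by_cases h1 : a = i <;> by_cases h2 : b = i <;> simp [h1, h2]

theorem star_to_star {m : ℕ} (hm : 2 ≤ m) (φ : Equiv.Perm (Sym2 (Fin (m+1))))
    (hφ : ∀ e, (φ e).IsDiag ↔ e.IsDiag)
    (h : ∀ (y : Fin (m+1) → Fin 1 → ℝ) (W : Matrix (Fin 2) (Fin m) ℝ),
      (W * gramMx (sqLenR y ∘ φ) * W.transpose).det = 0) (i : Fin (m+1)) :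
    ∃ v, ∀ e, e ∈ cutSet {v} ↔ φ e ∈ cutSet {i} := by
  set E : Sym2 (Fin (m+1)) → ℝ := sqLenR (ind i) ∘ φ with hE
  have hE01 : ∀ e, E e = if φ e ∈ cutSet {i} then 1 else 0 := fun e => sqLen_ind i _
  have hEv : ∀ e, E e = 0 ∨ E e = 1 := fun e => by rw [hE01]; split_ifs <;> simp
  have hdiag : ∀ a, E s(a,a) = 0 := by
    intro a
    have h1 : (φ s(a,a)).IsDiag := by rw [hφ]; simp
    rw [hE01]
    generalize φ s(a,a) = e at h1
    induction e using Sym2.ind with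
    | _ x y => simp at h1; simp [mem_cutSet, h1]
  have hmin := minor _ (h (ind i))
  have hcut : ∀ a b, E s(a,b) = (E s(0,a) - E s(0,b))^2 := by
    intro a b
    refine Fin.cases ?_ (fun a => ?_) a
    · rw [hdiag]; rcases hEv s(0,b) with h | h <;> rw [h] <;> norm_num
    · refine Fin.cases ?_ (fun b => ?_) b
      · rw [hdiag, Sym2.eq_swap]; rcases hEv s(0,a.succ) with h | h <;> rw [h] <;> norm_num
      · have := hmin a b
        simp only [← hE, gramMx, Matrix.of_apply, hdiag] at this
        rw [Sym2.eq_swap (a := b.succ)] at this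
        rcases hEv s(0,a.succ) with h1 | h1 <;> rcases hEv s(0,b.succ) with h2 | h2 <;>
        rcases hEv s(a.succ,b.succ) with h3 | h3 <;> simp only [h1, h2, h3] at this ⊢ <;> first | (exfalso; norm_num at this; done) | norm_num
  set S : Finset (Fin (m+1)) := Finset.univ.filter fun a => E s(0,a) = 1 with hS
  have hS' : ∀ e, e ∈ cutSet S ↔ φ e ∈ cutSet {i} := by
    intro e
    have h1 : φ e ∈ cutSet {i} ↔ E e = 1 := by rw [hE01]; split_ifs with hh <;> simp [hh]
    rw [h1]
    induction e using Sym2.ind with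
    | _ a b =>
      rw [mem_cutSet, hcut]
      simp only [hS, Finset.mem_filter, Finset.mem_univ, true_and]
      rcases hEv s(0,a) with h1 | h1 <;> rcases hEv s(0,b) with h2 | h2 <;> rw [h1, h2] <;> norm_num
  have hcard : (cutSet S).card = (cutSet {i}).card :=
    Finset.card_equiv φ hS'
  rw [card_cutSet, card_cutSet, Finset.card_singleton] at hcard
  have hle : S.card ≤ m + 1 := by simpa using Finset.card_le_univ S
  have h5 : S.card = 1 ∨ S.card = m := by
    obtain ⟨t, ht⟩ := Nat.exists_eq_add_of_le hle
    have h6 : m + 1 - S.card = t := by omega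
    rw [h6] at hcard
    zify at hcard ht
    push_cast at hcard ht
    have : ((S.card:ℤ) - 1) * (S.card - m) = 0 := by
      have : (t:ℤ) = m + 1 - S.card := by linarith
      rw [this] at hcard
      simp at hcard
      linarith
    rcases mul_eq_zero.1 this with h | h
    · left; omega
    · right; omega
  rcases h5 with h5 | h5
  · obtain ⟨v, hv⟩ := Finset.card_eq_one.1 h5
    exact ⟨v, by rw [← hv]; exact hS'⟩
  · have : Sᶜ.card = 1 := by rw [Finset.card_compl, h5]; simp
    obtain ⟨v, hv⟩ := Finset.card_eq_one.1 this
    exact ⟨v, by rw [← hv, cutSet_compl]; exact hS'⟩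

theorem exists_perm {n : ℕ} (hn : 3 ≤ n) (φ : Equiv.Perm (Sym2 (Fin n)))
    (h : ∀ i, ∃ v, ∀ e, e ∈ cutSet {v} ↔ φ e ∈ cutSet {i}) :
    ∃ σ : Equiv.Perm (Fin n), ∀ e : Sym2 (Fin n), ¬ e.IsDiag → φ (Sym2.map σ e) = e := by
  choose σ hσ using h
  have hinj : Function.Injective σ := by
    intro i j hij
    by_contra hne
    obtain ⟨k, hk⟩ : ∃ k, k ∉ ({i, j} : Finset (Fin n)) := by
      by_contra hc
      push Not at hc
      have := Finset.card_le_card (fun k _ => hc k : Finset.univ ⊆ ({i,j} : Finset (Fin n)))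
      have h2 := Finset.card_le_two (a := i) (b := j)
      rw [Finset.card_univ, Fintype.card_fin] at this
      omega
    have h1 := hσ i (φ.symm s(i,k))
    have h2 := hσ j (φ.symm s(i,k))
    rw [hij] at h1
    rw [h1] at h2
    simp [mem_cutSet] at h2 hk
    grind
  refine ⟨Equiv.ofBijective σ (Finite.injective_iff_bijective.1 hinj), ?_⟩
  intro e he
  induction e using Sym2.ind with
  | _ i j =>
    have hij : i ≠ j := by simpa using he
    have hne : σ i ≠ σ j := fun h => hij (hinj h)
    have h1 := (hσ i s(σ i, σ j)).1 (by simp [mem_cutSet, hne.symm])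
    have h2 := (hσ j s(σ i, σ j)).1 (by simp [mem_cutSet, hne])
    change φ s(σ i, σ j) = _
    generalize φ s(σ i, σ j) = e' at h1 h2
    induction e' using Sym2.ind with
    | _ a b =>
      simp [mem_cutSet] at h1 h2 ⊢
      grind

theorem exists_congruence {n d : ℕ} (p r : Fin (n+1) → Fin d → ℝ)
    (h : ∀ i j, sqLenR p s(i,j) = sqLenR r s(i,j)) :
    ∃ f : (Fin d → ℝ) → (Fin d → ℝ), IsCongruence f ∧ ∀ i, r i = f (p i) := by
  have hdist : ∀ x y : Fin d → ℝ, eudist x y = ‖(WithLp.toLp 2 x - WithLp.toLp 2 y : EuclideanSpace ℝ (Fin d))‖ := by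
    intro x y
    rw [EuclideanSpace.norm_eq]
    simp [eudist]
  let P : Fin (n+1) → EuclideanSpace ℝ (Fin d) := fun i => WithLp.toLp 2 (p i)
  let Q : Fin (n+1) → EuclideanSpace ℝ (Fin d) := fun i => WithLp.toLp 2 (r i)
  have hPQ : ∀ i j, ‖P i - P j‖ = ‖Q i - Q j‖ := by
    intro i j
    rw [← hdist, ← hdist]
    exact congrArg Real.sqrt (h i j)
  let TP : (Fin (n+1) → ℝ) →ₗ[ℝ] EuclideanSpace ℝ (Fin d) := Fintype.linearCombination ℝ (fun i => P i - P 0)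
  let TQ : (Fin (n+1) → ℝ) →ₗ[ℝ] EuclideanSpace ℝ (Fin d) := Fintype.linearCombination ℝ (fun i => Q i - Q 0)
  have hin : ∀ i j, inner ℝ (P i - P 0) (P j - P 0) = inner ℝ (Q i - Q 0) (Q j - Q 0) := by
    intro i j
    rw [real_inner_eq_norm_mul_self_add_norm_mul_self_sub_norm_sub_mul_self_div_two,
      real_inner_eq_norm_mul_self_add_norm_mul_self_sub_norm_sub_mul_self_div_two]
    simp only [sub_sub_sub_cancel_right, hPQ]
  have hnorm : ∀ c, ‖TP c‖ = ‖TQ c‖ := by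
    intro c
    have : inner ℝ (TP c) (TP c) = inner ℝ (TQ c) (TQ c) := by
      simp only [TP, TQ, Fintype.linearCombination_apply, sum_inner, inner_sum, inner_smul_left,
        inner_smul_right, hin]
    rw [real_inner_self_eq_norm_sq, real_inner_self_eq_norm_sq] at this
    exact (sq_eq_sq₀ (norm_nonneg _) (norm_nonneg _)).1 this
  obtain ⟨g, hg⟩ : ∃ g : EuclideanSpace ℝ (Fin d) →ₗ[ℝ] EuclideanSpace ℝ (Fin d), g ∘ₗ TP = TQ := by
    have hker : LinearMap.ker TP ≤ LinearMap.ker TQ := by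
      intro c hc
      rw [LinearMap.mem_ker] at hc ⊢
      rw [← norm_eq_zero, ← hnorm, hc, norm_zero]
    obtain ⟨g, hg⟩ := LinearMap.exists_extend
      (((LinearMap.ker TP).liftQ TQ hker) ∘ₗ TP.quotKerEquivRange.symm.toLinearMap)
    refine ⟨g, LinearMap.ext fun c => ?_⟩
    have h1 := LinearMap.congr_fun hg ⟨TP c, c, rfl⟩
    have h2 := LinearMap.quotKerEquivRange_symm_apply_image TP c ⟨c, rfl⟩
    simp only [LinearMap.comp_apply, LinearEquiv.coe_coe, h2] at h1
    exact h1
  have hgn : ∀ v : LinearMap.range TP, ‖(g.domRestrict (LinearMap.range TP)) v‖ = ‖v‖ := by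
    rintro ⟨v, c, rfl⟩
    have := LinearMap.congr_fun hg c
    simp only [LinearMap.comp_apply] at this
    simp only [LinearMap.domRestrict_apply, this, Submodule.coe_norm, hnorm]
  let L0 : LinearMap.range TP →ₗᵢ[ℝ] EuclideanSpace ℝ (Fin d) := ⟨g.domRestrict (LinearMap.range TP), hgn⟩
  let L : EuclideanSpace ℝ (Fin d) →ₗᵢ[ℝ] EuclideanSpace ℝ (Fin d) := L0.extend
  have hL : ∀ i, L (P i - P 0) = Q i - Q 0 := by
    intro i
    have h1 : TP (Pi.single i 1) = P i - P 0 := by simp [TP]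
    have h2 : TQ (Pi.single i 1) = Q i - Q 0 := by simp [TQ]
    have h3 := L0.extend_apply ⟨TP (Pi.single i 1), _, rfl⟩
    rw [← h1, ← h2, ← hg]
    exact h3
  let L' : EuclideanSpace ℝ (Fin d) ≃ₗᵢ[ℝ] EuclideanSpace ℝ (Fin d) := L.toLinearIsometryEquiv rfl
  have hL' : ∀ v, L' v = L v := fun v => rfl
  let A : EuclideanSpace ℝ (Fin d) ≃ EuclideanSpace ℝ (Fin d) := ((Equiv.subRight (P 0)).trans L'.toEquiv).trans (Equiv.addRight (Q 0))
  have hA : ∀ v, A v = L (v - P 0) + Q 0 := fun v => rfl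
  let B : (Fin d → ℝ) ≃ (Fin d → ℝ) := ((WithLp.equiv 2 (Fin d → ℝ)).symm.trans A).trans (WithLp.equiv 2 (Fin d → ℝ))
  have hB : ∀ x, WithLp.toLp 2 (B x) = L (WithLp.toLp 2 x - P 0) + Q 0 := fun v => rfl
  refine ⟨B, ⟨B.bijective, ?_⟩, ?_⟩
  · intro x y
    rw [hdist, hdist, hB, hB, add_sub_add_right_eq_sub, ← map_sub, L.norm_map]
    simp
  · intro i
    apply WithLp.toLp_injective 2
    rw [hB]
    change Q i = L (P i - P 0) + Q 0
    rw [hL]; simp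

theorem unlabeled_complete_edge_lengths_determine_configuration
    {d n N : ℕ} (hd : 1 ≤ d) (hn : d + 2 ≤ n) (hN : N = n.choose 2)
    (p q : Fin n → Fin d → ℝ) (hp : GenericConfig p)
    (G H : Fin N → Sym2 (Fin n))
    (hGinj : Function.Injective G) (hGdiag : ∀ k, ¬ (G k).IsDiag)
    (hGall : ∀ e : Sym2 (Fin n), ¬ e.IsDiag → ∃ k, G k = e)
    (hHinj : Function.Injective H) (hHdiag : ∀ k, ¬ (H k).IsDiag)
    (hHall : ∀ e : Sym2 (Fin n), ¬ e.IsDiag → ∃ k, H k = e)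
    (hv : ∀ k, sqLenR p (G k) = sqLenR q (H k)) :
    ∃ σ : Equiv.Perm (Fin n), ∃ f : (Fin d → ℝ) → (Fin d → ℝ),
      IsCongruence f ∧ (∀ i, q (σ i) = f (p i)) ∧
      (∀ k, Sym2.map σ (G k) = H k) := by
  obtain ⟨m, rfl⟩ : ∃ m, n = m + 1 := ⟨n - 1, by omega⟩
  let eG : Fin N ≃ {e : Sym2 (Fin (m+1)) // ¬ e.IsDiag} :=
    Equiv.ofBijective (fun k => ⟨G k, hGdiag k⟩)
      ⟨fun a b h => hGinj (congrArg Subtype.val h), fun e => by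
        obtain ⟨k, hk⟩ := hGall e.1 e.2
        exact ⟨k, Subtype.ext hk⟩⟩
  let eH : Fin N ≃ {e : Sym2 (Fin (m+1)) // ¬ e.IsDiag} :=
    Equiv.ofBijective (fun k => ⟨H k, hHdiag k⟩)
      ⟨fun a b h => hHinj (congrArg Subtype.val h), fun e => by
        obtain ⟨k, hk⟩ := hHall e.1 e.2
        exact ⟨k, Subtype.ext hk⟩⟩
  let φ : Equiv.Perm (Sym2 (Fin (m+1))) := Equiv.Perm.ofSubtype (eH.symm.trans eG)
  have hφH : ∀ k, φ (H k) = G k := by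
    intro k
    have h1 := Equiv.Perm.ofSubtype_apply_coe (eH.symm.trans eG) (eH k)
    simp only [Equiv.trans_apply, Equiv.symm_apply_apply] at h1
    exact h1
  have hφd : ∀ e, e.IsDiag → φ e = e := fun e he =>
    Equiv.Perm.ofSubtype_apply_of_not_mem _ (not_not.2 he)
  have hφ : ∀ e, (φ e).IsDiag ↔ e.IsDiag := by
    intro e
    by_cases he : e.IsDiag
    · rw [hφd e he]
    · obtain ⟨k, rfl⟩ := hHall e he
      rw [hφH]
      simp [hGdiag, hHdiag]
  have hq : sqLenR q = sqLenR p ∘ φ := by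
    funext e
    by_cases he : e.IsDiag
    · rw [Function.comp, hφd e he]
      induction e using Sym2.ind with
      | _ a b => simp at he; simp [sqLenR, he]
    · obtain ⟨k, rfl⟩ := hHall e he
      rw [Function.comp, hφH, hv]
  have ht := transfer_real p q hp φ hq
  have h1 := rank_one hd (by omega) φ hφ ht
  obtain ⟨σ, hσ⟩ := exists_perm (by omega) φ (star_to_star (by omega) φ hφ h1)
  obtain ⟨f, hf, hfp⟩ := exists_congruence p (fun i => q (σ i)) (by
    intro i j
    by_cases hij : i = j
    · subst hij; simp [sqLenR]
    · have h2 := hσ s(i,j) (by simpa using hij)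
      have h3 := congrFun hq (Sym2.map σ s(i,j))
      rw [Function.comp, h2] at h3
      rw [← h3]
      simp [sqLenR])
  refine ⟨σ, f, hf, hfp, fun k => ?_⟩
  apply φ.injective
  rw [hσ _ (hGdiag k), hφH]
end

section
/- Let d ≥ 2 and let p be a generic configuration of n ≥ d+2 points in ℝ^d. Let v = ⟨G, p⟩², where G is an edge measurement ensemble that allows for trilateration. Suppose there is a configuration q of n points in ℝ^d together with an edge measurement ensemble H such that v = ⟨H, q⟩². Then there is a vertex relabeling of q such that, up to congruence, q = p, and moreover, under this vertex relabeling, G = H. -/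
/-- An edge measurement ensemble `G` allows for trilateration in `d` dimensions
if, after reordering the vertices (by a permutation `π`), it contains all edges
of the complete subgraph `K_{d+2}` on the first `d+2` vertices and, for every
later vertex `j`, it contains `d+1` edges from `j` back to earlier vertices. -/
def EdgeTrilat {n m : ℕ} (d : ℕ) (G : Fin m → Sym2 (Fin n)) : Prop :=
  ∃ π : Equiv.Perm (Fin n),
    (∀ i j : Fin n, i.val < d + 2 → j.val < d + 2 → i ≠ j →
      ∃ k, G k = s(π i, π j)) ∧
    (∀ j : Fin n, d + 2 ≤ j.val →
      ∃ I : Fin (d + 1) → Fin n, Function.Injective I ∧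
        ∀ t, (I t).val < j.val ∧ ∃ k, G k = s(π (I t), π j))


theorem aux_lift {P A B : Type} [CommRing P] [CommRing A] [CommRing B]
    (i : P →+* A) (j : P →+* B) (g : B →+* A) (hg : g.comp j = i)
    (hi : i.FormallySmooth) (hs : Function.Surjective g)
    (hk : IsNilpotent (RingHom.ker g)) :
    ∃ f : A →+* B, f.comp i = j ∧ g.comp f = RingHom.id A := by
  let _ := i.toAlgebra
  let _ := j.toAlgebra
  have : Algebra.FormallySmooth P A := hi
  let g' : B →ₐ[P] A := { g with commutes' := fun r => congrArg (fun h => h r) hg }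
  have h1 := Algebra.FormallySmooth.liftOfSurjective_apply (AlgHom.id P A) g' hs hk
  refine ⟨(Algebra.FormallySmooth.liftOfSurjective (AlgHom.id P A) g' hs hk).toRingHom, ?_, ?_⟩
  · ext x
    exact (Algebra.FormallySmooth.liftOfSurjective (AlgHom.id P A) g' hs hk).commutes x
  · ext x
    exact h1 x

theorem aux_smooth {P : Type} [CommRing P] [IsDomain P] [CharZero P] (i : P →+* ℝ) (hi : Function.Injective i) :
    i.FormallySmooth := by
  let _ := i.toAlgebra
  have : FaithfulSMul P ℝ := (faithfulSMul_iff_algebraMap_injective P ℝ).2 hi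
  let : Algebra (FractionRing P) ℝ := FractionRing.liftAlgebra P ℝ
  have : IsScalarTower P (FractionRing P) ℝ := inferInstance
  have : CharZero (FractionRing P) := inferInstance
  obtain ⟨s, hs⟩ := exists_isTranscendenceBasis (FractionRing P) ℝ
  have := hs.isAlgebraic_field
  have : Algebra.FormallySmooth (FractionRing P) ℝ :=
    Algebra.FormallySmooth.of_algebraicIndependent_of_isSeparable hs.1
  have : Algebra.FormallySmooth P (FractionRing P) := .of_isLocalization (nonZeroDivisors P)
  exact Algebra.FormallySmooth.comp P (FractionRing P) ℝ

theorem exists_deriv {n d : ℕ} {p : Fin n → Fin d → ℝ} (hp : GenericConfig p)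
    (t : Fin n → Fin d → ℝ) :
    ∃ D : ℝ →+ ℝ, (∀ x y, D (x * y) = x * D y + y * D x) ∧ ∀ i k, D (p i k) = t i k := by
  let i : MvPolynomial (Fin n × Fin d) ℚ →+* ℝ :=
    (MvPolynomial.aeval (fun ik : Fin n × Fin d => p ik.1 ik.2)).toRingHom
  have hi : Function.Injective i := by
    rw [injective_iff_map_eq_zero]
    intro a ha
    by_contra h
    exact hp a h ha
  let j : MvPolynomial (Fin n × Fin d) ℚ →+* TrivSqZeroExt ℝ ℝ :=
    (MvPolynomial.aeval (fun ik : Fin n × Fin d =>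
      TrivSqZeroExt.inl (p ik.1 ik.2) + TrivSqZeroExt.inr (t ik.1 ik.2))).toRingHom
  let g : TrivSqZeroExt ℝ ℝ →+* ℝ := (TrivSqZeroExt.fstHom ℝ ℝ ℝ).toRingHom
  obtain ⟨f, hf1, hf2⟩ := aux_lift i j g (by
      ext x
      · simp
      · simp [i, j, g]) (aux_smooth i hi) (fun x => ⟨TrivSqZeroExt.inl x, rfl⟩)
      ⟨2, by
        rw [Submodule.zero_eq_bot, eq_bot_iff, pow_two, Ideal.mul_le]
        intro a ha b hb
        have ha : a.fst = 0 := ha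
        have hb : b.fst = 0 := hb
        simp only [Ideal.mem_bot]
        ext <;> simp [ha, hb]⟩
  have hfst : ∀ x, (f x).fst = x := fun x => congrArg (fun h => h x) hf2
  refine ⟨⟨⟨fun x => (f x).snd, by simp⟩, by simp⟩, ?_, ?_⟩
  · intro x y
    simp [hfst]
    ring
  · intro a k
    have := congrArg (fun h => h (MvPolynomial.X (a, k))) hf1
    simp [i, j] at this
    simp [this]

theorem gen_ne {n d : ℕ} {p : Fin n → Fin d → ℝ} (hp : GenericConfig p)
    (F : MvPolynomial (Fin n × Fin d) ℚ) (p0 : Fin n × Fin d → ℚ)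
    (h : MvPolynomial.eval p0 F ≠ 0) :
    MvPolynomial.aeval (fun ik : Fin n × Fin d => p ik.1 ik.2) F ≠ 0 :=
  hp F (fun h0 => h (by rw [h0]; simp))

theorem gen_det {n d : ℕ} {p : Fin n → Fin d → ℝ} (hp : GenericConfig p) {s : ℕ} (hs : s ≤ d)
    (I : Fin s → Fin n) (hI : Function.Injective I) (j : Fin n) (hj : ∀ t, I t ≠ j) :
    (Matrix.of fun t c : Fin s => p j (Fin.castLE hs c) - p (I t) (Fin.castLE hs c)).det ≠ 0 := by
  classical
  let M : Matrix (Fin s) (Fin s) (MvPolynomial (Fin n × Fin d) ℚ) :=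
    Matrix.of fun t c => MvPolynomial.X (j, Fin.castLE hs c) - MvPolynomial.X (I t, Fin.castLE hs c)
  let p0 : Fin n × Fin d → ℚ := fun vc =>
    if vc.1 = j then 0 else if ∃ t, I t = vc.1 ∧ t.val = vc.2.val then -1 else 0
  have h := gen_ne hp M.det p0 (by
    rw [RingHom.map_det]
    have : (MvPolynomial.eval p0).mapMatrix M = 1 := by
      ext t c
      have h1 : p0 (j, Fin.castLE hs c) = 0 := by simp [p0]
      have h2 : p0 (I t, Fin.castLE hs c) = if t = c then -1 else 0 := by
        simp only [p0, hj t, if_false, Fin.val_castLE]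
        by_cases htc : t = c
        · rw [if_pos ⟨t, rfl, by rw [htc]⟩, if_pos htc]
        · rw [if_neg, if_neg htc]
          rintro ⟨u, hu, hu2⟩
          exact htc ((hI hu).symm.trans (Fin.ext hu2))
      simp only [M, RingHom.mapMatrix_apply, Matrix.map_apply, Matrix.of_apply, map_sub,
        MvPolynomial.eval_X, h1, h2, Matrix.one_apply]
      split_ifs <;> simp
    rw [this]; simp)
  rw [AlgHom.map_det] at h
  convert h using 2
  ext t c
  simp [M]

/-- directional derivative of half the squared length -/
noncomputable def dLen {n d : ℕ} (p t : Fin n → Fin d → ℝ) : Sym2 (Fin n) → ℝ :=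
  Sym2.lift ⟨fun i j => ∑ k, (p i k - p j k) * (t i k - t j k),
    fun i j => Finset.sum_congr rfl fun k _ => by ring⟩

@[simp] theorem dLen_mk {n d : ℕ} (p t : Fin n → Fin d → ℝ) (i j : Fin n) :
    dLen p t s(i, j) = ∑ k, (p i k - p j k) * (t i k - t j k) := rfl

@[simp] theorem sqLenR_mk {n d : ℕ} (p : Fin n → Fin d → ℝ) (i j : Fin n) :
    sqLenR p s(i, j) = ∑ k, (p i k - p j k) ^ 2 := rfl

theorem sqLen_inj {n d : ℕ} (hd : 1 ≤ d) {p : Fin n → Fin d → ℝ} (hp : GenericConfig p)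
    (e e' : Sym2 (Fin n)) (he : ¬ e.IsDiag) (h : sqLenR p e = sqLenR p e') : e = e' := by
  classical
  by_contra hne
  have key : ∀ a b x y : Fin n, a ≠ b → a ≠ x → a ≠ y →
      sqLenR p s(a, b) ≠ sqLenR p s(x, y) := by
    intro a b x y hab hax hay heq
    let F : MvPolynomial (Fin n × Fin d) ℚ :=
      ∑ k, (MvPolynomial.X (a, k) - MvPolynomial.X (b, k)) ^ 2 -
      ∑ k, (MvPolynomial.X (x, k) - MvPolynomial.X (y, k)) ^ 2
    refine gen_ne hp F (fun vc => if vc.1 = a ∧ vc.2.val = 0 then 1 else 0) ?_ ?_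
    · simp only [F, map_sub, map_sum, map_pow, MvPolynomial.eval_X, hab.symm, hax.symm, hay.symm,
        false_and, if_false, true_and]
      rw [Finset.sum_eq_single (⟨0, hd⟩ : Fin d)]
      · simp
      · intro k _ hk
        have : k.val ≠ 0 := fun h => hk (Fin.ext h)
        simp [this]
      · simp
    · simp only [F, map_sub, map_sum, map_pow, MvPolynomial.aeval_X]
      simp only [sqLenR_mk] at heq
      rw [heq, sub_self]
  induction e with | _ a b
  induction e' with | _ x y
  have hab : a ≠ b := by simpa using he
  by_cases h1 : a ≠ x ∧ a ≠ y
  · exact key a b x y hab h1.1 h1.2 h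
  by_cases h2 : b ≠ x ∧ b ≠ y
  · rw [Sym2.eq_swap] at h
    exact key b a x y hab.symm h2.1 h2.2 h
  apply hne
  rw [Sym2.eq_iff]
  grind

theorem deriv_sqLen {n d : ℕ} (D : ℝ →+ ℝ) (hD : ∀ x y, D (x * y) = x * D y + y * D x)
    (q : Fin n → Fin d → ℝ) (e : Sym2 (Fin n)) :
    D (sqLenR q e) = 2 * dLen q (fun i k => D (q i k)) e := by
  induction e with | _ a b
  simp only [sqLenR_mk, dLen_mk, map_sum, Finset.mul_sum, pow_two, hD, map_sub]
  refine Finset.sum_congr rfl fun k _ => by ring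

/-- trilateration with the identity order, for edge sets -/
def Tri {n : ℕ} (d : ℕ) (E : Finset (Sym2 (Fin n))) : Prop :=
  (∀ i j : Fin n, i.val < d + 2 → j.val < d + 2 → i ≠ j → s(i, j) ∈ E) ∧
  (∀ j : Fin n, d + 2 ≤ j.val →
      ∃ I : Fin (d + 1) → Fin n, Function.Injective I ∧
        ∀ t, (I t).val < j.val ∧ s(I t, j) ∈ E)

theorem Tri.nbrs {n d : ℕ} {E : Finset (Sym2 (Fin n))} (h : Tri d E) (j : Fin n) :
    ∃ I : Fin (min j.val d) → Fin n, Function.Injective I ∧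
        ∀ t, (I t).val < j.val ∧ s(I t, j) ∈ E := by
  by_cases hj : j.val < d + 2
  · refine ⟨fun t => ⟨t.val, by omega⟩, fun a b hab => ?_, fun t => ⟨by simp; omega, ?_⟩⟩
    · simpa [Fin.ext_iff] using hab
    · apply h.1
      · simp; omega
      · exact hj
      · intro hh
        have := congrArg Fin.val hh
        simp at this
        omega
  · obtain ⟨I, hI, hI2⟩ := h.2 j (by omega)
    exact ⟨fun t => I (Fin.castLE (by omega) t), fun a b hab => by
      simpa using hI hab, fun t => hI2 _⟩

/-- pinned directions -/
def pinned (n d : ℕ) : Submodule ℝ (Fin n → Fin d → ℝ) where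
  carrier := {t | ∀ i k, i.val ≤ k.val → t i k = 0}
  add_mem' := by intro a b ha hb i k h; simp [ha i k h, hb i k h]
  zero_mem' := by intro i k h; rfl
  smul_mem' := by intro c a ha i k h; simp [ha i k h]

theorem inf_rigid {n d : ℕ} {p : Fin n → Fin d → ℝ} (hp : GenericConfig p)
    {E : Finset (Sym2 (Fin n))} (hE : Tri d E) (t : Fin n → Fin d → ℝ) (ht : t ∈ pinned n d)
    (h : ∀ e ∈ E, dLen p t e = 0) : t = 0 := by
  suffices H : ∀ m : ℕ, ∀ j : Fin n, j.val = m → t j = 0 by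
    ext j k; rw [H _ j rfl]; rfl
  intro m
  induction m using Nat.strong_induction_on with
  | _ m ih =>
  intro j hjm
  obtain ⟨I, hI, hI2⟩ := hE.nbrs j
  have hs : min j.val d ≤ d := min_le_right _ _
  have hdet := gen_det hp hs I hI j (fun u hu => by have := (hI2 u).1; rw [hu] at this; omega)
  have hz := Matrix.eq_zero_of_mulVec_eq_zero hdet (v := fun c => t j (Fin.castLE hs c)) (by
    ext u
    have h1 := h _ (hI2 u).2
    have h2 : t (I u) = 0 := ih _ (by have := (hI2 u).1; omega) (I u) rfl
    simp only [dLen_mk, h2, Pi.zero_apply, zero_sub] at h1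
    simp only [Matrix.mulVec, dotProduct, Matrix.of_apply, Pi.zero_apply]
    rw [← h1]
    refine Finset.sum_of_injOn (Fin.castLE hs) (Fin.castLE_injective hs).injOn (by simp) ?_ ?_
    · intro k _ hk
      have : j.val ≤ k.val := by
        by_contra hc
        apply hk
        simp only [Finset.coe_univ, Set.image_univ, Set.mem_range]
        exact ⟨⟨k.val, by have := k.2; omega⟩, by ext; simp⟩
      rw [ht j k this]; simp
    · intro c _; ring)
  ext k
  by_cases hk : j.val ≤ k.val
  · exact ht j k hk
  · have := congrFun hz ⟨k.val, by have := k.2; omega⟩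
    simpa using this

theorem exists_pin {n d : ℕ} (hn : d < n) (q : Fin n → Fin d → ℝ) (τ : Equiv.Perm (Fin n)) :
    ∃ B : (Fin d → ℝ) →ₗ[ℝ] (Fin d → ℝ), Function.Injective B ∧
      (∀ e, sqLenR (fun i => B (q i - q (τ ⟨0, by omega⟩))) e = sqLenR q e) ∧
      ∀ i k, i.val ≤ k.val → B (q (τ i) - q (τ ⟨0, by omega⟩)) k = 0 := by
  let f : Fin d → EuclideanSpace ℝ (Fin d) := fun k =>
    WithLp.toLp 2 (q (τ ⟨k.val + 1, by omega⟩) - q (τ ⟨0, by omega⟩))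
  let b := InnerProductSpace.gramSchmidtOrthonormalBasis (𝕜 := ℝ) (by simp) f
  let L : (Fin d → ℝ) ≃ₗ[ℝ] (Fin d → ℝ) :=
    (WithLp.linearEquiv 2 ℝ (Fin d → ℝ)).symm ≪≫ₗ b.repr.toLinearEquiv ≪≫ₗ
      WithLp.linearEquiv 2 ℝ (Fin d → ℝ)
  have hL : ∀ x k, L x k = b.repr (WithLp.toLp 2 x) k := fun x k => rfl
  have hnorm : ∀ x, ∑ k, (L x k) ^ 2 = ∑ k, (x k) ^ 2 := by
    intro x
    have h1 := b.repr.norm_map (WithLp.toLp 2 x)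
    have h2 := EuclideanSpace.real_norm_sq_eq (b.repr (WithLp.toLp 2 x))
    have h3 := EuclideanSpace.real_norm_sq_eq (WithLp.toLp 2 x)
    rw [h1, h3] at h2
    exact h2.symm
  refine ⟨L.toLinearMap, L.injective, ?_, ?_⟩
  · intro e
    induction e with | _ x y
    simp only [sqLenR_mk]
    have := hnorm (q x - q y)
    simp only [Pi.sub_apply] at this
    rw [← this]
    refine Finset.sum_congr rfl fun k _ => ?_
    congr 1
    change L _ k - L _ k = _
    rw [← Pi.sub_apply, ← map_sub, sub_sub_sub_cancel_right]
  · intro i k hik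
    change L _ k = 0
    rcases i with ⟨_ | i, hi⟩
    · simp
    · rw [hL]
      have := InnerProductSpace.gramSchmidtOrthonormalBasis_inv_triangular' (𝕜 := ℝ) (by simp) f
        (j := k) (i := ⟨i, by simp at hik; omega⟩) (by simp at hik; exact hik)
      exact this

theorem exists_deriv_map {n d : ℕ} {p q q' : Fin n → Fin d → ℝ} (hp : GenericConfig p)
    {E : Finset (Sym2 (Fin n))} (φ : Sym2 (Fin n) → Sym2 (Fin n))
    (hφ : ∀ e ∈ E, sqLenR q (φ e) = sqLenR p e) (hq' : ∀ e, sqLenR q' e = sqLenR q e)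
    (t : Fin n → Fin d → ℝ) :
    ∃ D : ℝ →+ ℝ, ∀ e ∈ E, dLen p t e = dLen q' (fun i k => D (q' i k)) (φ e) := by
  obtain ⟨D, hD, hDp⟩ := exists_deriv hp t
  refine ⟨D, fun e he => ?_⟩
  have h1 := deriv_sqLen D hD p e
  have h2 := deriv_sqLen D hD q' (φ e)
  rw [hq', hφ e he, h1] at h2
  simp only [hDp] at h2
  linarith

theorem dLen_add {n d : ℕ} (p s t : Fin n → Fin d → ℝ) (e : Sym2 (Fin n)) :
    dLen p (s + t) e = dLen p s e + dLen p t e := by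
  induction e with | _ a b
  simp only [dLen_mk, ← Finset.sum_add_distrib, Pi.add_apply]
  exact Finset.sum_congr rfl fun k _ => by ring

theorem dLen_smul {n d : ℕ} (p t : Fin n → Fin d → ℝ) (c : ℝ) (e : Sym2 (Fin n)) :
    dLen p (c • t) e = c * dLen p t e := by
  induction e with | _ a b
  simp only [dLen_mk, Finset.mul_sum, Pi.smul_apply, smul_eq_mul]
  exact Finset.sum_congr rfl fun k _ => by ring

theorem transfer {n d : ℕ} (hn : d < n) {p q q' : Fin n → Fin d → ℝ} (hp : GenericConfig p)
    {E : Finset (Sym2 (Fin n))} (hE : Tri d E) (φ : Sym2 (Fin n) → Sym2 (Fin n))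
    (hφ : ∀ e ∈ E, sqLenR q (φ e) = sqLenR p e) (hq' : ∀ e, sqLenR q' e = sqLenR q e)
    (τ : Equiv.Perm (Fin n)) (hpin : ∀ i k, i.val ≤ k.val → q' (τ i) k = 0) :
    (∀ ω : Sym2 (Fin n) → ℝ, (∀ t, ∑ e ∈ E, ω e * dLen p t e = 0) →
      ∀ t ∈ pinned n d, ∑ e ∈ E, ω e * dLen q' (fun i => t (τ.symm i)) (φ e) = 0) ∧
    ∀ k : Fin d, q' (τ ⟨k.val + 1, by omega⟩) k ≠ 0 := by
  let A : pinned n d →ₗ[ℝ] (E → ℝ) :=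
    { toFun := fun t e => dLen p t.1 e.1
      map_add' := fun s t => by ext e; exact dLen_add _ _ _ _
      map_smul' := fun c t => by ext e; exact dLen_smul _ _ _ _ }
  let B : pinned n d →ₗ[ℝ] (E → ℝ) :=
    { toFun := fun t e => dLen q' (fun i => t.1 (τ.symm i)) (φ e.1)
      map_add' := fun s t => by ext e; exact dLen_add _ _ _ _
      map_smul' := fun c t => by ext e; exact dLen_smul _ _ _ _ }
  have hA : Function.Injective A := by
    rw [injective_iff_map_eq_zero]
    intro t ht
    exact Subtype.ext (inf_rigid hp hE t.1 t.2 (fun e he => congrFun ht ⟨e, he⟩))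
  have hAB : ∀ t : pinned n d, ∃ s : pinned n d, A t = B s ∧
      ∀ i k, q' (τ i) k = 0 → s.1 i k = 0 := by
    intro t
    obtain ⟨D, hD⟩ := exists_deriv_map hp φ hφ hq' t.1
    refine ⟨⟨fun i k => D (q' (τ i) k), fun i k hik => by
      change D _ = 0
      rw [hpin i k hik, map_zero]⟩, ?_, ?_⟩
    · ext e
      change dLen p t.1 e.1 = dLen q' (fun i k => D (q' (τ (τ.symm i)) k)) (φ e.1)
      simp only [Equiv.apply_symm_apply]
      exact hD e.1 e.2
    · intro i k h
      change D _ = 0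
      rw [h, map_zero]
  have hle : LinearMap.range A ≤ LinearMap.range B := by
    rintro _ ⟨t, rfl⟩
    obtain ⟨s, hs, -⟩ := hAB t
    exact ⟨s, hs.symm⟩
  have hfA := LinearMap.finrank_range_of_inj hA
  have hfB := LinearMap.finrank_range_le B
  have heq : LinearMap.range A = LinearMap.range B :=
    Submodule.eq_of_le_of_finrank_le hle (by rw [hfA]; exact hfB)
  have hB : Function.Injective B := by
    rw [← LinearMap.ker_eq_bot]
    have h1 := LinearMap.finrank_range_add_finrank_ker B
    rw [← heq, hfA] at h1
    exact Submodule.finrank_eq_zero.1 (by omega)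
  constructor
  · intro ω hω t ht
    have : B ⟨t, ht⟩ ∈ LinearMap.range A := by rw [heq]; exact ⟨_, rfl⟩
    obtain ⟨s, hs⟩ := this
    rw [← hω s.1]
    refine Finset.sum_congr rfl fun e he => ?_
    have := congrFun hs ⟨e, he⟩
    change dLen p s.1 e = dLen q' (fun i => t (τ.symm i)) (φ e) at this
    rw [this]
  · intro k hk
    let t : Fin n → Fin d → ℝ := fun i c => if i.val = k.val + 1 ∧ c = k then 1 else 0
    have ht : t ∈ pinned n d := by
      intro i c hic
      simp only [t]
      rw [if_neg]
      rintro ⟨h1, h2⟩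
      subst h2
      omega
    have : B ⟨t, ht⟩ ∈ LinearMap.range A := by rw [heq]; exact ⟨_, rfl⟩
    obtain ⟨s, hs⟩ := this
    obtain ⟨r, hr, hr0⟩ := hAB s
    have h1 : r = ⟨t, ht⟩ := hB (hr.symm.trans hs)
    have h2 := hr0 _ _ hk
    rw [h1] at h2
    simp [t] at h2

theorem dLen_single_sum {n d : ℕ} (q : Fin n → Fin d → ℝ) (W : Sym2 (Fin n) → ℝ) (i : Fin n)
    (w : Fin d → ℝ) :
    ∑ f, W f * dLen q (Pi.single i w) f = ∑ j, W s(i, j) * ∑ k, (q i k - q j k) * w k := by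
  classical
  symm
  refine Finset.sum_of_injOn (fun j => s(i, j)) ?_ (by simp) ?_ ?_
  · intro a _ b _ hab
    simp at hab
    grind
  · intro f _ hf
    induction f with | _ a b
    have ha : a ≠ i := by
      rintro rfl
      exact hf ⟨b, by simp, rfl⟩
    have hb : b ≠ i := by
      rintro rfl
      exact hf ⟨a, by simp, Sym2.eq_swap⟩
    simp [Pi.single_eq_of_ne ha, Pi.single_eq_of_ne hb]
  · intro j _
    simp only [dLen_mk, Pi.single_eq_same]
    by_cases hj : j = i
    · subst hj; simp
    · simp [Pi.single_eq_of_ne hj]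

/-- push forward of a weight -/
def pushW {n : ℕ} {R : Type*} [CommRing R] (E : Finset (Sym2 (Fin n)))
    (φ : Sym2 (Fin n) → Sym2 (Fin n)) (ω : Sym2 (Fin n) → R) (f : Sym2 (Fin n)) : R :=
  ∑ e ∈ E with φ e = f, ω e

theorem pushW_sum {n : ℕ} (E : Finset (Sym2 (Fin n)))
    (φ : Sym2 (Fin n) → Sym2 (Fin n)) (ω g : Sym2 (Fin n) → ℝ) :
    ∑ e ∈ E, ω e * g (φ e) = ∑ f, pushW E φ ω f * g f := by
  rw [← Finset.sum_fiberwise E φ]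
  refine Finset.sum_congr rfl fun f _ => ?_
  rw [pushW, Finset.sum_mul]
  refine Finset.sum_congr rfl fun e he => ?_
  rw [(Finset.mem_filter.1 he).2]

theorem q_stress {n d : ℕ} (hn : d < n) {p q : Fin n → Fin d → ℝ} (hp : GenericConfig p)
    {E : Finset (Sym2 (Fin n))} (hE : Tri d E) (φ : Sym2 (Fin n) → Sym2 (Fin n))
    (hφ : ∀ e ∈ E, sqLenR q (φ e) = sqLenR p e)
    (ω : Sym2 (Fin n) → ℝ) (hω : ∀ t, ∑ e ∈ E, ω e * dLen p t e = 0) (i : Fin n) (k : Fin d) :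
    ∑ j, pushW E φ ω s(i, j) * (q i k - q j k) = 0 := by
  classical
  let l : Fin n := ⟨n - 1, by omega⟩
  let τ : Equiv.Perm (Fin n) := Equiv.swap i l
  have hτ : τ l = i := Equiv.swap_apply_right _ _
  have hτ' : τ.symm = τ := Equiv.symm_swap _ _
  obtain ⟨B, hB, hBs, hBp⟩ := exists_pin hn q τ
  obtain ⟨h1, -⟩ := transfer hn hp hE φ hφ hBs τ hBp
  have h2 : ∀ c : Fin d, ∑ j, pushW E φ ω s(i, j) * B (q i - q j) c = 0 := by
    intro c
    have h3 := h1 ω hω (Pi.single l (Pi.single c 1)) (by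
      intro a b hab
      have : a ≠ l := by
        rintro rfl
        have := b.2
        simp only [l] at hab
        omega
      rw [Pi.single_eq_of_ne this]; rfl)
    have h4 : (fun a => (Pi.single l (Pi.single c 1) : Fin n → Fin d → ℝ) (τ.symm a)) =
        Pi.single i (Pi.single c 1) := by
      ext a b
      rw [hτ']
      by_cases ha : a = i
      · subst ha
        rw [Pi.single_eq_same, ← hτ, Equiv.swap_apply_self, Pi.single_eq_same]
      · rw [Pi.single_eq_of_ne ha, Pi.single_eq_of_ne]
        intro h
        apply ha
        rw [← hτ, ← h, Equiv.swap_apply_self]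
    rw [h4, pushW_sum E φ ω, dLen_single_sum] at h3
    rw [← h3]
    refine Finset.sum_congr rfl fun j _ => ?_
    congr 1
    rw [Finset.sum_eq_single c]
    · rw [Pi.single_eq_same, mul_one, ← Pi.sub_apply, ← map_sub, sub_sub_sub_cancel_right]
    · intro b _ hb
      rw [Pi.single_eq_of_ne hb, mul_zero]
    · simp
  have h5 : B (∑ j, pushW E φ ω s(i, j) • (q i - q j)) = 0 := by
    ext c
    simp only [map_sum, map_smul, Finset.sum_apply, Pi.smul_apply, smul_eq_mul, Pi.zero_apply]
    exact h2 c
  have h6 := (map_eq_zero_iff B hB).1 h5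
  have h7 := congrFun h6 k
  simpa using h7

theorem exists_perm_first {n : ℕ} (S : Finset (Fin n)) :
    ∃ τ : Equiv.Perm (Fin n), ∀ j ∈ S, (τ.symm j).val < S.card := by
  classical
  have hc : S.card ≤ n := by simpa using S.card_le_univ
  let e : {x // x ∈ S} ≃ {x : Fin n // x.val < S.card} :=
    (S.equivFin).trans
      { toFun := fun a => ⟨Fin.castLE hc a, a.2⟩
        invFun := fun x => ⟨x.1.1, x.2⟩
        left_inv := fun a => rfl
        right_inv := fun a => rfl }
  refine ⟨(e.extendSubtype).symm, fun j hj => ?_⟩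
  rw [Equiv.symm_symm, Equiv.extendSubtype_apply_of_mem e j hj]
  exact (e ⟨j, hj⟩).2

theorem q_indep {n d : ℕ} (hn : d < n) {p q : Fin n → Fin d → ℝ} (hp : GenericConfig p)
    {E : Finset (Sym2 (Fin n))} (hE : Tri d E) (φ : Sym2 (Fin n) → Sym2 (Fin n))
    (hφ : ∀ e ∈ E, sqLenR q (φ e) = sqLenR p e)
    (r : Fin n → ℝ) (S : Finset (Fin n)) (hS : S.card ≤ d + 1) (hr : ∀ j, r j ≠ 0 → j ∈ S)
    (h0 : ∑ j, r j = 0) (h1 : ∀ k, ∑ j, r j * q j k = 0) (j : Fin n) : r j = 0 := by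
  classical
  obtain ⟨τ, hτ⟩ := exists_perm_first S
  obtain ⟨B, hB, hBs, hBp⟩ := exists_pin hn q τ
  obtain ⟨-, hd⟩ := transfer hn hp hE φ hφ hBs τ hBp
  have hsum : ∀ k, ∑ i, r (τ i) * B (q (τ i) - q (τ ⟨0, by omega⟩)) k = 0 := by
    intro k
    rw [Equiv.sum_comp τ (fun i => r i * B (q i - q (τ ⟨0, by omega⟩)) k)]
    have : ∑ j, r j • (q j - q (τ ⟨0, by omega⟩)) = 0 := by
      ext c
      simp only [Finset.sum_apply, Pi.smul_apply, Pi.sub_apply, smul_eq_mul, mul_sub,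
        Finset.sum_sub_distrib, ← Finset.sum_mul, h0, h1, Pi.zero_apply]
      ring
    have h2 := congrFun (congrArg B this) k
    simpa using h2
  have key : ∀ m : ℕ, ∀ i : Fin n, n - i.val = m → 1 ≤ i.val → r (τ i) = 0 := by
    intro m
    induction m using Nat.strong_induction_on with
    | _ m ih =>
    intro i him hi
    by_contra hne
    have h2 := hτ _ (hr _ hne)
    rw [Equiv.symm_apply_apply] at h2
    have h3 := hsum ⟨i.val - 1, by omega⟩
    rw [Finset.sum_eq_single i] at h3
    · have h4 := hd ⟨i.val - 1, by omega⟩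
      have h5 : (⟨i.val - 1 + 1, by omega⟩ : Fin n) = i := by ext; simp; omega
      simp only [h5] at h4
      rcases mul_eq_zero.1 h3 with h | h
      · exact hne h
      · exact h4 h
    · intro b _ hb
      have hb' : b.val ≠ i.val := fun h => hb (Fin.ext h)
      by_cases hbi : b.val ≤ i.val - 1
      · rw [hBp b _ hbi, mul_zero]
      · rw [ih (n - b.val) (by omega) b rfl (by omega), zero_mul]
    · simp
  have hz : r (τ ⟨0, by omega⟩) = 0 := by
    rw [← Equiv.sum_comp τ, Finset.sum_eq_single (⟨0, by omega⟩ : Fin n)] at h0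
    · exact h0
    · intro b _ hb
      refine key _ b rfl ?_
      have : b.val ≠ 0 := fun h => hb (Fin.ext h)
      omega
    · simp
  obtain ⟨i, rfl⟩ := τ.surjective j
  by_cases hi : i.val = 0
  · have : i = ⟨0, by omega⟩ := Fin.ext hi
    rw [this]; exact hz
  · exact key _ i rfl (by omega)

theorem exists_poly_aux {n d : ℕ} (o l : Fin n) (I : Fin d → Fin n) (hI : Function.Injective I)
    (hol : o ≠ l) (hIo : ∀ i, I i ≠ o) (hIl : ∀ i, I i ≠ l) :
    ∃ A : Fin n → MvPolynomial (Fin n × Fin d) ℚ, ∑ v, A v = 0 ∧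
      (∀ c, ∑ v, A v * MvPolynomial.X (v, c) = 0) ∧
      (∀ v, v ≠ o → v ≠ l → (∀ i, I i ≠ v) → A v = 0) ∧
      ∀ b : Fin d → ℚ, ∃ p0 : Fin n × Fin d → ℚ,
        MvPolynomial.eval p0 (A l) = -1 ∧ MvPolynomial.eval p0 (A o) = 1 - ∑ i, b i ∧
        ∀ i, MvPolynomial.eval p0 (A (I i)) = b i := by
  classical
  let M : Matrix (Fin d) (Fin d) (MvPolynomial (Fin n × Fin d) ℚ) :=
    Matrix.of fun c i => MvPolynomial.X (I i, c) - MvPolynomial.X (o, c)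
  let B : Fin d → MvPolynomial (Fin n × Fin d) ℚ :=
    fun c => MvPolynomial.X (l, c) - MvPolynomial.X (o, c)
  let C := Matrix.cramer M B
  let A : Fin n → MvPolynomial (Fin n × Fin d) ℚ := fun v =>
    (if v = l then - M.det else 0) + (if v = o then M.det - ∑ i, C i else 0) +
      ∑ i, if v = I i then C i else 0
  have hAl : A l = - M.det := by
    simp only [A, if_true, hol.symm, if_false]
    rw [Finset.sum_eq_zero]
    · ring
    · intro i _; rw [if_neg (hIl i).symm]
  have hAo : A o = M.det - ∑ i, C i := by
    simp only [A, if_true, hol, if_false]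
    rw [Finset.sum_eq_zero (s := Finset.univ) (f := fun i => if o = I i then C i else 0)]
    · ring
    · intro i _; rw [if_neg (hIo i).symm]
  have hAI : ∀ i, A (I i) = C i := by
    intro i
    simp only [A, hIo, hIl, if_false, hI.eq_iff]
    simp
  have hsum : ∀ g : Fin n → MvPolynomial (Fin n × Fin d) ℚ,
      ∑ v, A v * g v = - M.det * g l + (M.det - ∑ i, C i) * g o + ∑ i, C i * g (I i) := by
    intro g
    simp only [A, add_mul, Finset.sum_add_distrib, Finset.sum_mul, ite_mul, zero_mul]
    rw [Finset.sum_comm]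
    simp
  refine ⟨A, ?_, ?_, ?_, ?_⟩
  · have := hsum (fun _ => 1)
    simp only [mul_one] at this
    rw [this]; ring
  · intro c
    rw [hsum]
    have h1 := congrFun (Matrix.mulVec_cramer M B) c
    simp only [Matrix.mulVec, dotProduct, Pi.smul_apply, smul_eq_mul] at h1
    have h2 : ∑ i, M c i * C i = ∑ i, C i * MvPolynomial.X (I i, c) -
        (∑ i, C i) * MvPolynomial.X (o, c) := by
      rw [Finset.sum_mul, ← Finset.sum_sub_distrib]
      refine Finset.sum_congr rfl fun i _ => ?_
      simp only [M, Matrix.of_apply]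
      ring
    rw [h2] at h1
    simp only [B] at h1
    linear_combination h1
  · intro v h1 h2 h3
    simp only [A, h1, h2, if_false]
    rw [Finset.sum_eq_zero]
    · ring
    · intro i _; rw [if_neg (h3 i).symm]
  · intro b
    let p0 : Fin n × Fin d → ℚ := fun vc =>
      if vc.1 = l then b vc.2 else if vc.1 = I vc.2 then 1 else 0
    have hM : (MvPolynomial.eval p0).mapMatrix M = 1 := by
      ext c i
      simp only [M, RingHom.mapMatrix_apply, Matrix.map_apply, Matrix.of_apply, map_sub,
        MvPolynomial.eval_X, p0, hIl, hol, if_false, (hIo c).symm, hI.eq_iff, Matrix.one_apply,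
        sub_zero]
      simp only [eq_comm]
    have hC : ∀ i, MvPolynomial.eval p0 (C i) = b i := by
      intro i
      simp only [C]
      rw [Matrix.cramer_apply, RingHom.map_det, RingHom.mapMatrix_apply, Matrix.map_updateCol,
        ← RingHom.mapMatrix_apply, hM, ← Matrix.cramer_apply, Matrix.cramer_one]
      simp [B, p0, hol, (hIo i).symm]
    have hD : MvPolynomial.eval p0 M.det = 1 := by
      rw [RingHom.map_det, hM, Matrix.det_one]
    refine ⟨p0, ?_, ?_, ?_⟩
    · rw [hAl, map_neg, hD]
    · rw [hAo, map_sub, hD, map_sum]; simp only [hC]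
    · intro i; rw [hAI, hC]

theorem exists_poly {n d : ℕ} (hd : 1 ≤ d) (S : Finset (Fin n)) (hS : S.card = d + 2)
    (o : Fin n) (ho : o ∈ S) :
    ∃ A : Fin n → MvPolynomial (Fin n × Fin d) ℚ, ∑ v, A v = 0 ∧
      (∀ c, ∑ v, A v * MvPolynomial.X (v, c) = 0) ∧
      (∀ v, v ∉ S → A v = 0) ∧ (∀ v ∈ S, A v ≠ 0) ∧
      ∃ p0 : Fin n × Fin d → ℚ, MvPolynomial.eval p0 (A o) = 0 ∧
        ∀ v ∈ S, v ≠ o → MvPolynomial.eval p0 (A v) ≠ 0 := by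
  classical
  have h1 : (S.erase o).card = d + 1 := by rw [Finset.card_erase_of_mem ho, hS]; rfl
  obtain ⟨l, hl⟩ : (S.erase o).Nonempty := by rw [← Finset.card_pos]; omega
  have h2 : ((S.erase o).erase l).card = d := by rw [Finset.card_erase_of_mem hl, h1]; rfl
  let e := ((S.erase o).erase l).equivFinOfCardEq h2
  let I : Fin d → Fin n := fun i => (e.symm i).1
  have hIm : ∀ i, I i ∈ (S.erase o).erase l := fun i => (e.symm i).2
  have hcov : ∀ v ∈ S, v ≠ o → v ≠ l → ∃ i, I i = v := by
    intro v hv hvo hvl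
    exact ⟨e ⟨v, by simp [hv, hvo, hvl]⟩, by simp [I]⟩
  have hlo : l ≠ o := (Finset.mem_erase.1 hl).1
  obtain ⟨A, hA0, hA1, hA2, hA3⟩ := exists_poly_aux o l I
    (fun a b hab => e.symm.injective (Subtype.ext hab)) hlo.symm
    (fun i => by have := hIm i; simp only [Finset.mem_erase] at this; tauto)
    (fun i => by have := hIm i; simp only [Finset.mem_erase] at this; tauto)
  have hdq : (d : ℚ) ≠ 0 := by exact_mod_cast (by omega : d ≠ 0)
  have hp1 : ∃ p0 : Fin n × Fin d → ℚ, MvPolynomial.eval p0 (A o) = 0 ∧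
        ∀ v ∈ S, v ≠ o → MvPolynomial.eval p0 (A v) ≠ 0 := by
    obtain ⟨p0, h3, h4, h5⟩ := hA3 (fun _ => 1 / d)
    refine ⟨p0, ?_, ?_⟩
    · rw [h4]; simp [hdq]
    · intro v hv hvo
      by_cases hvl : v = l
      · rw [hvl, h3]; norm_num
      · obtain ⟨i, rfl⟩ := hcov v hv hvo hvl
        rw [h5]; positivity
  refine ⟨A, hA0, hA1, ?_, ?_, hp1⟩
  · intro v hv
    refine hA2 v ?_ ?_ ?_
    · rintro rfl; exact hv ho
    · rintro rfl; exact hv (Finset.mem_of_mem_erase hl)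
    · rintro i rfl
      exact hv (Finset.mem_of_mem_erase (Finset.mem_of_mem_erase (hIm i)))
  · intro v hv h0
    by_cases hvo : v = o
    · obtain ⟨p0, h3, h4, h5⟩ := hA3 0
      rw [← hvo, h0] at h4
      simp at h4
    · obtain ⟨p0, -, h⟩ := hp1
      apply h v hv hvo
      rw [h0, map_zero]

/-- edges of the complete graph on a finset -/
def kE {n : ℕ} (S : Finset (Fin n)) : Finset (Sym2 (Fin n)) :=
  S.sym2.filter fun e => ¬ e.IsDiag

theorem mem_kE {n : ℕ} {S : Finset (Fin n)} {a b : Fin n} :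
    s(a, b) ∈ kE S ↔ a ∈ S ∧ b ∈ S ∧ a ≠ b := by
  simp [kE, and_assoc]

theorem kE_nd {n : ℕ} {S : Finset (Fin n)} {e : Sym2 (Fin n)} (h : e ∈ kE S) : ¬ e.IsDiag :=
  (Finset.mem_filter.1 h).2

theorem kE_star {n : ℕ} (S : Finset (Fin n)) (z : Fin n) (hz : z ∈ S) :
    ((kE S).filter fun e => z ∈ e).card = S.card - 1 := by
  classical
  rw [← Finset.card_erase_of_mem hz]
  symm
  refine Finset.card_bij (fun x _ => s(z, x)) ?_ ?_ ?_
  · intro x hx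
    rw [Finset.mem_erase] at hx
    rw [Finset.mem_filter, mem_kE]
    exact ⟨⟨hz, hx.2, hx.1.symm⟩, by simp⟩
  · intro x hx y hy h
    simp at h
    grind
  · intro e he
    rw [Finset.mem_filter] at he
    obtain ⟨h1, x, rfl⟩ := he
    rw [mem_kE] at h1
    exact ⟨x, by simp [h1.2.1, h1.2.2.symm], rfl⟩

theorem deg_sum {n : ℕ} (F : Finset (Sym2 (Fin n))) (hF : ∀ f ∈ F, ¬ f.IsDiag) :
    ∑ i, (Finset.univ.filter fun j => s(i, j) ∈ F).card = 2 * F.card := by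
  classical
  have h1 : ∑ i, (Finset.univ.filter fun j => s(i, j) ∈ F).card =
      ((Finset.univ : Finset (Fin n × Fin n)).filter fun x => s(x.1, x.2) ∈ F).card := by
    simp only [Finset.card_filter]
    rw [Fintype.sum_prod_type]
  rw [h1, Finset.card_eq_sum_card_fiberwise (f := fun x => s(x.1, x.2)) (t := F)]
  · rw [Finset.sum_const_nat (m := 2)]
    · ring
    intro f hf
    induction f with | _ a b
    have hab : a ≠ b := by simpa using hF _ hf
    have : (Finset.filter (fun x : Fin n × Fin n => s(x.1, x.2) = s(a, b))
        (Finset.filter (fun x => s(x.1, x.2) ∈ F) Finset.univ)) = {(a, b), (b, a)} := by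
      ext ⟨x, y⟩
      simp only [Finset.mem_filter, Finset.mem_univ, true_and, Finset.mem_insert,
        Finset.mem_singleton, Prod.mk.injEq, Sym2.eq_iff]
      constructor
      · exact fun h => h.2
      · rintro (⟨rfl, rfl⟩ | ⟨rfl, rfl⟩)
        · exact ⟨hf, by simp⟩
        · exact ⟨by rw [Sym2.eq_swap]; exact hf, by simp⟩
    rw [this, Finset.card_pair]
    intro h
    exact hab (Prod.mk.inj h).1
  · intro x hx
    simpa using hx

theorem kE_card {n : ℕ} (S : Finset (Fin n)) : 2 * (kE S).card = S.card * (S.card - 1) := by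
  classical
  rw [← deg_sum _ fun f hf => kE_nd hf]
  rw [← Finset.sum_subset (Finset.subset_univ S)]
  · rw [Finset.sum_const_nat]
    intro x hx
    rw [← Finset.card_erase_of_mem hx]
    congr 1
    ext j
    simp [mem_kE, hx, and_comm, eq_comm]
  · intro x _ hx
    simp [mem_kE, hx]

theorem graph1 {n d : ℕ} (F : Finset (Sym2 (Fin n))) (hF : ∀ f ∈ F, ¬ f.IsDiag)
    (hc : 2 * F.card = (d + 2) * (d + 1))
    (hdeg : ∀ i, (∀ j, s(i, j) ∉ F) ∨ d + 1 ≤ (Finset.univ.filter fun j => s(i, j) ∈ F).card) :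
    ∃ S : Finset (Fin n), S.card = d + 2 ∧ F = kE S := by
  classical
  let S : Finset (Fin n) := Finset.univ.filter fun i => ∃ j, s(i, j) ∈ F
  have hS : ∀ i j, s(i, j) ∈ F → i ∈ S := fun i j h => by simp [S]; exact ⟨j, h⟩
  have hdS : ∀ i ∈ S, d + 1 ≤ (Finset.univ.filter fun j => s(i, j) ∈ F).card := by
    intro i hi
    rcases hdeg i with h | h
    · obtain ⟨j, hj⟩ := (Finset.mem_filter.1 hi).2
      exact absurd hj (h j)
    · exact h
  have h1 : S.card * (d + 1) ≤ (d + 2) * (d + 1) := by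
    rw [← hc, ← deg_sum F hF]
    calc S.card * (d + 1) ≤ ∑ i ∈ S, (Finset.univ.filter fun j => s(i, j) ∈ F).card := by
          rw [← smul_eq_mul]; exact Finset.card_nsmul_le_sum _ _ _ hdS
      _ ≤ _ := Finset.sum_le_sum_of_subset (Finset.subset_univ _)
  have h2 : S.card ≤ d + 2 := Nat.le_of_mul_le_mul_right h1 (by omega)
  have h3 : d + 2 ≤ S.card := by
    have : F.Nonempty := by
      rw [← Finset.card_pos]
      by_contra h
      have : F.card = 0 := by omega
      rw [this] at hc
      have : 0 < (d + 2) * (d + 1) := by positivity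
      omega
    obtain ⟨f, hf⟩ := this
    induction f with | _ a b
    have h4 := hdS a (hS _ _ hf)
    have h5 : insert a (Finset.univ.filter fun j => s(a, j) ∈ F) ⊆ S := by
      intro x hx
      rw [Finset.mem_insert] at hx
      rcases hx with rfl | hx
      · exact hS _ _ hf
      · have := (Finset.mem_filter.1 hx).2
        rw [Sym2.eq_swap] at this
        exact hS _ _ this
    have h6 := Finset.card_le_card h5
    rw [Finset.card_insert_of_notMem] at h6
    · omega
    · intro h
      exact hF _ (Finset.mem_filter.1 h).2 (by simp)
  have h4 : S.card = d + 2 := le_antisymm h2 h3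
  refine ⟨S, h4, Finset.eq_of_subset_of_card_le ?_ ?_⟩
  · intro f hf
    induction f with | _ a b
    rw [mem_kE]
    refine ⟨hS _ _ hf, hS b a (by rw [Sym2.eq_swap]; exact hf), by simpa using hF _ hf⟩
  · have := kE_card S
    rw [h4] at this
    have h5 : d + 2 - 1 = d + 1 := by omega
    rw [h5] at this
    omega

theorem graph2 {n d : ℕ} (S : Finset (Fin n)) (hS : S.card = d + 2)
    (F : Finset (Sym2 (Fin n))) (hF : F ⊆ kE S)
    (hc : 2 * F.card = (d + 1) * d)
    (htr : ∀ k l m, l ≠ m → s(k, l) ∈ F → s(k, m) ∈ F → s(l, m) ∈ F) :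
    ∃ z ∈ S, ∀ x, s(z, x) ∉ F := by
  classical
  have hnd : ∀ f ∈ F, ¬ f.IsDiag := fun f hf => kE_nd (hF hf)
  obtain ⟨k, hkS, hk⟩ : ∃ k ∈ S, d ≤ (Finset.univ.filter fun j => s(k, j) ∈ F).card := by
    by_contra! hcon
    have h1 := deg_sum F hnd
    rw [hc, ← Finset.sum_subset (Finset.subset_univ S)] at h1
    · have h2 : ∑ i ∈ S, ((Finset.univ.filter fun j => s(i, j) ∈ F).card + 1) ≤ S.card • d :=
        Finset.sum_le_card_nsmul _ _ _ fun i hi => hcon i hi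
      rw [Finset.sum_add_distrib, h1, hS] at h2
      simp only [Finset.sum_const, hS, smul_eq_mul, mul_one] at h2
      nlinarith
    · intro x _ hx
      rw [Finset.card_eq_zero, Finset.filter_eq_empty_iff]
      intro j _ hj
      exact hx (mem_kE.1 (hF hj)).1
  let N := insert k (Finset.univ.filter fun j => s(k, j) ∈ F)
  have hN : N.card = (Finset.univ.filter fun j => s(k, j) ∈ F).card + 1 := by
    rw [Finset.card_insert_of_notMem]
    intro h
    exact hnd _ (Finset.mem_filter.1 h).2 (by simp)
  have hNF : kE N ⊆ F := by
    intro f hf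
    induction f with | _ a b
    rw [mem_kE] at hf
    obtain ⟨ha, hb, hab⟩ := hf
    simp only [N, Finset.mem_insert, Finset.mem_filter, Finset.mem_univ, true_and] at ha hb
    rcases ha with rfl | ha
    · rcases hb with rfl | hb
      · exact absurd rfl hab
      · exact hb
    · rcases hb with rfl | hb
      · rw [Sym2.eq_swap]; exact ha
      · exact htr k a b hab ha hb
  have h1 := Finset.card_le_card hNF
  have h2 := kE_card N
  have h3 : N.card = d + 1 := by
    by_contra hne
    have h4 : d + 2 ≤ N.card := by omega
    have : (d + 2) * (d + 1) ≤ N.card * (N.card - 1) := Nat.mul_le_mul h4 (by omega)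
    nlinarith
  have h4 : kE N = F := by
    refine Finset.eq_of_subset_of_card_le hNF ?_
    rw [h3] at h2
    have : d + 1 - 1 = d := by omega
    rw [this] at h2
    omega
  obtain ⟨z, hz, hzN⟩ := Finset.exists_mem_notMem_of_card_lt_card (s := N) (t := S) (by omega)
  refine ⟨z, hz, fun x hx => hzN ?_⟩
  rw [← h4, mem_kE] at hx
  exact hx.1

/-- product weight -/
def om {n : ℕ} {R : Type*} [CommRing R] (a : Fin n → R) : Sym2 (Fin n) → R :=
  Sym2.lift ⟨fun i j => a i * a j, fun i j => mul_comm _ _⟩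

@[simp] theorem om_mk {n : ℕ} {R : Type*} [CommRing R] (a : Fin n → R) (i j : Fin n) :
    om a s(i, j) = a i * a j := rfl

theorem map_om {n : ℕ} {R R' : Type*} [CommRing R] [CommRing R'] (g : R →+* R') (a : Fin n → R)
    (e : Sym2 (Fin n)) : g (om a e) = om (fun v => g (a v)) e := by
  induction e with | _ i j
  simp

theorem map_pushW {n : ℕ} {R R' : Type*} [CommRing R] [CommRing R'] (g : R →+* R')
    (E : Finset (Sym2 (Fin n))) (φ : Sym2 (Fin n) → Sym2 (Fin n)) (a : Fin n → R)
    (f : Sym2 (Fin n)) : g (pushW E φ (om a) f) = pushW E φ (om fun v => g (a v)) f := by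
  simp [pushW, map_sum, map_om]

theorem pushW_apply {n : ℕ} {R : Type*} [CommRing R] (E : Finset (Sym2 (Fin n)))
    (φ : Sym2 (Fin n) → Sym2 (Fin n)) (hφ : Set.InjOn φ E) (ω : Sym2 (Fin n) → R)
    (e : Sym2 (Fin n)) (he : e ∈ E) : pushW E φ ω (φ e) = ω e := by
  rw [pushW, Finset.sum_eq_single e]
  · intro b hb hbe
    rw [Finset.mem_filter] at hb
    exact absurd (hφ hb.1 he hb.2) hbe
  · intro h
    exact (h (Finset.mem_filter.2 ⟨he, rfl⟩)).elim

theorem pushW_ne {n : ℕ} {R : Type*} [CommRing R] (E : Finset (Sym2 (Fin n)))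
    (φ : Sym2 (Fin n) → Sym2 (Fin n)) (ω : Sym2 (Fin n) → R)
    (f : Sym2 (Fin n)) (h : pushW E φ ω f ≠ 0) : ∃ e ∈ E, φ e = f := by
  by_contra! hcon
  apply h
  rw [pushW, Finset.sum_eq_zero]
  intro e he
  rw [Finset.mem_filter] at he
  exact absurd he.2 (hcon e he.1)

theorem stress {n d : ℕ} (p t : Fin n → Fin d → ℝ) (a : Fin n → ℝ) (h0 : ∑ v, a v = 0)
    (h1 : ∀ c, ∑ v, a v * p v c = 0) (E : Finset (Sym2 (Fin n)))
    (hE : ∀ i j, i ≠ j → a i ≠ 0 → a j ≠ 0 → s(i, j) ∈ E) :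
    ∑ e ∈ E, om a e * dLen p t e = 0 := by
  classical
  rw [Finset.sum_subset (Finset.subset_univ E)]
  · have h2 : ∀ e, dLen p t e = ∑ i, dLen p (Pi.single i (t i)) e := by
      intro e
      induction e with | _ x y
      simp only [dLen_mk]
      rw [Finset.sum_comm]
      refine Finset.sum_congr rfl fun k _ => ?_
      rw [← Finset.mul_sum, Finset.sum_sub_distrib]
      congr 2
      · rw [Finset.sum_eq_single x]
        · simp
        · intro b _ hb; rw [Pi.single_eq_of_ne hb.symm]; rfl
        · simp
      · rw [Finset.sum_eq_single y]
        · simp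
        · intro b _ hb; rw [Pi.single_eq_of_ne hb.symm]; rfl
        · simp
    simp only [h2, Finset.mul_sum]
    rw [Finset.sum_comm]
    refine Finset.sum_eq_zero fun i _ => ?_
    rw [dLen_single_sum]
    simp only [om_mk, Finset.mul_sum]
    rw [Finset.sum_comm]
    refine Finset.sum_eq_zero fun k _ => ?_
    have : ∀ j, a i * a j * ((p i k - p j k) * t i k) =
        a i * t i k * p i k * a j - a i * t i k * (a j * p j k) := fun j => by ring
    simp only [this, Finset.sum_sub_distrib, ← Finset.mul_sum, h0, h1]
    ring
  · intro e _ he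
    induction e with | _ x y
    by_cases hxy : x = y
    · subst hxy; simp
    · by_cases hx : a x = 0
      · simp [hx]
      · by_cases hy : a y = 0
        · simp [hy]
        · exact absurd (hE x y hxy hx hy) he

section star
variable {n d : ℕ} {q : Fin n → Fin d → ℝ} {W : Sym2 (Fin n) → ℝ}

theorem W_deg
    (hind : ∀ (r : Fin n → ℝ) (S : Finset (Fin n)), S.card ≤ d + 1 → (∀ j, r j ≠ 0 → j ∈ S) →
      ∑ j, r j = 0 → (∀ k, ∑ j, r j * q j k = 0) → ∀ j, r j = 0)
    (hdiag : ∀ i, W s(i, i) = 0)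
    (hW : ∀ i k, ∑ j, W s(i, j) * (q i k - q j k) = 0) (i : Fin n) :
    (∀ j, W s(i, j) = 0) ∨ d + 1 ≤ (Finset.univ.filter fun j => W s(i, j) ≠ 0).card := by
  classical
  by_contra! hcon
  obtain ⟨⟨j, hj⟩, h2⟩ := hcon
  have hji : j ≠ i := by rintro rfl; exact hj (hdiag _)
  have := hind (fun j => W s(i, j) - if j = i then ∑ x, W s(i, x) else 0)
    (insert i (Finset.univ.filter fun j => W s(i, j) ≠ 0))
    ((Finset.card_insert_le _ _).trans (by omega)) (by
      intro x hx
      by_cases hxi : x = i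
      · simp [hxi]
      · simp only [hxi, if_false, sub_zero] at hx
        simp [hx]) (by simp) (by
      intro k
      have h3 := hW i k
      simp only [mul_sub, Finset.sum_sub_distrib, ← Finset.sum_mul] at h3
      simp only [sub_mul, Finset.sum_sub_distrib, ite_mul, zero_mul]
      simp only [Finset.sum_ite_eq', Finset.mem_univ, if_true]
      linarith) j
  simp [hji] at this
  exact hj this

theorem W_star
    (hind : ∀ (r : Fin n → ℝ) (S : Finset (Fin n)), S.card ≤ d + 1 → (∀ j, r j ≠ 0 → j ∈ S) →
      ∑ j, r j = 0 → (∀ k, ∑ j, r j * q j k = 0) → ∀ j, r j = 0)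
    (hdiag : ∀ i, W s(i, i) = 0)
    (hW : ∀ i k, ∑ j, W s(i, j) * (q i k - q j k) = 0)
    (S : Finset (Fin n)) (hS : S.card = d + 2) (hWS : ∀ i j, W s(i, j) ≠ 0 → i ∈ S)
    (k l m : Fin n) (hkl : k ≠ l) (hkm : k ≠ m) (hlm : l ≠ m) :
    W s(k, l) * W s(k, m) + W s(l, m) * ∑ x, W s(k, x) = 0 := by
  classical
  by_cases hk : k ∈ S
  swap
  · have : ∀ x, W s(k, x) = 0 := fun x => by
      by_contra h
      exact hk (hWS _ _ h)
    simp [this]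
  by_cases hl : l ∈ S
  swap
  · have h1 : ∀ x, W s(l, x) = 0 := fun x => by
      by_contra h
      exact hl (hWS _ _ h)
    have h2 : W s(k, l) = 0 := by rw [Sym2.eq_swap]; exact h1 k
    simp [h1, h2]
  let Ω : Fin n → Fin n → ℝ := fun i j => W s(i, j) - if j = i then ∑ x, W s(i, x) else 0
  have hΩ0 : ∀ i, ∑ j, Ω i j = 0 := by intro i; simp [Ω]
  have hΩ1 : ∀ i c, ∑ j, Ω i j * q j c = 0 := by
    intro i c
    have h3 := hW i c
    simp only [mul_sub, Finset.sum_sub_distrib, ← Finset.sum_mul] at h3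
    simp only [Ω, sub_mul, Finset.sum_sub_distrib, ite_mul, zero_mul]
    simp only [Finset.sum_ite_eq', Finset.mem_univ, if_true]
    linarith
  have hΩS : ∀ i ∈ S, ∀ j, Ω i j ≠ 0 → j ∈ S := by
    intro i hi j hj
    by_cases hji : j = i
    · rw [hji]; exact hi
    · simp only [Ω, hji, if_false, sub_zero] at hj
      rw [Sym2.eq_swap] at hj
      exact hWS _ _ hj
  have hs : Ω l k = W s(k, l) := by simp [Ω, hkl]; rw [Sym2.eq_swap]
  have hkk : Ω k k = - ∑ x, W s(k, x) := by simp [Ω, hdiag]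
  have := hind (fun j => Ω l k * Ω k j - Ω k k * Ω l j) (S.erase k)
    (by rw [Finset.card_erase_of_mem hk]; omega) (by
      intro j hj
      rw [Finset.mem_erase]
      constructor
      · rintro rfl
        apply hj; ring
      · by_contra hjS
        apply hj
        have h1 : Ω k j = 0 := by by_contra h; exact hjS (hΩS k hk _ h)
        have h2 : Ω l j = 0 := by by_contra h; exact hjS (hΩS l hl _ h)
        simp [h1, h2])
    (by simp only [Finset.sum_sub_distrib, ← Finset.mul_sum, hΩ0]; ring)
    (by
      intro c
      have : ∀ j, (Ω l k * Ω k j - Ω k k * Ω l j) * q j c =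
        Ω l k * (Ω k j * q j c) - Ω k k * (Ω l j * q j c) := fun j => by ring
      simp only [this, Finset.sum_sub_distrib, ← Finset.mul_sum, hΩ1]; ring) m
  simp only [hs, hkk] at this
  have h1 : Ω k m = W s(k, m) := by simp [Ω, hkm.symm]
  have h2 : Ω l m = W s(l, m) := by simp [Ω, hlm.symm]
  rw [h1, h2] at this
  linarith

end star

theorem nz_iff {n : ℕ} {R : Type*} [CommRing R] [IsDomain R] (E : Finset (Sym2 (Fin n)))
    (hE : ∀ e ∈ E, ¬ e.IsDiag)
    (φ : Sym2 (Fin n) → Sym2 (Fin n)) (hφ : Set.InjOn φ E) (a : Fin n → R) (S : Finset (Fin n))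
    (hS : kE S ⊆ E) (ha : ∀ v, a v ≠ 0 ↔ v ∈ S) (f : Sym2 (Fin n)) :
    pushW E φ (om a) f ≠ 0 ↔ f ∈ (kE S).image φ := by
  classical
  have key : ∀ e ∈ E, om a e ≠ 0 ↔ e ∈ kE S := by
    intro e he
    have := hE e he
    induction e with | _ x y
    have hxy : x ≠ y := by simpa using this
    rw [mem_kE, om_mk, mul_ne_zero_iff, ha, ha]
    tauto
  constructor
  · intro h
    obtain ⟨e, he, rfl⟩ := pushW_ne _ _ _ _ h
    rw [pushW_apply E φ hφ _ e he] at h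
    exact Finset.mem_image_of_mem _ ((key e he).1 h)
  · intro h
    obtain ⟨e, he, rfl⟩ := Finset.mem_image.1 h
    rw [pushW_apply E φ hφ _ e (hS he)]
    exact (key e (hS he)).2 he

theorem core_o {n d : ℕ} (hd : 2 ≤ d) (hn : d < n) {p q : Fin n → Fin d → ℝ}
    (hp : GenericConfig p) {E : Finset (Sym2 (Fin n))} (hE : Tri d E)
    (hEd : ∀ e ∈ E, ¬ e.IsDiag) (φ : Sym2 (Fin n) → Sym2 (Fin n))
    (hφ : ∀ e ∈ E, sqLenR q (φ e) = sqLenR p e)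
    (S : Finset (Fin n)) (hS : S.card = d + 2) (hSE : kE S ⊆ E) (o : Fin n) (ho : o ∈ S) :
    ∃ z, ∀ e ∈ kE S, z ∈ φ e ↔ o ∈ e := by
  classical
  have hinj : Set.InjOn φ E := by
    intro e he e' he' h
    apply sqLen_inj (by omega) hp e e' (hEd e he)
    rw [← hφ e he, ← hφ e' he', h]
  have hφd : ∀ e ∈ E, ¬ (φ e).IsDiag := by
    intro e he hdiag
    have hz : sqLenR q (φ e) = 0 := by
      induction hf : φ e with | _ x y
      rw [hf] at hdiag
      have : x = y := by simpa using hdiag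
      subst this
      simp
    rw [hφ e he] at hz
    have : e = s(o, o) := sqLen_inj (by omega) hp e _ (hEd e he) (by rw [hz]; simp)
    exact hEd e he (by rw [this]; simp)
  obtain ⟨A, hA0, hA1, hA2, hA3, p0, hp0, hp1⟩ := exists_poly (by omega : 1 ≤ d) S hS o ho
  let ev : MvPolynomial (Fin n × Fin d) ℚ →+* ℝ :=
    (MvPolynomial.aeval (fun ik : Fin n × Fin d => p ik.1 ik.2)).toRingHom
  have hev : ∀ f, f ≠ 0 → ev f ≠ 0 := fun f hf => hp f hf
  let a : Fin n → ℝ := fun v => ev (A v)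
  have ha : ∀ v, a v ≠ 0 ↔ v ∈ S := by
    intro v
    constructor
    · intro h
      by_contra hv
      apply h
      simp only [a, hA2 v hv, map_zero]
    · intro hv
      exact hev _ (hA3 v hv)
  let W := pushW E φ (om a)
  have hst := q_stress hn hp hE φ hφ (om a) (fun t => stress p t a
    (by simp only [a, ← map_sum, hA0, map_zero])
    (by
      intro c
      have := congrArg ev (hA1 c)
      rw [map_sum, map_zero] at this
      rw [← this]
      refine Finset.sum_congr rfl fun v _ => ?_
      rw [map_mul]
      congr 1
      simp [ev]) E
    (by
      intro i j hij hi hj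
      exact hSE (mem_kE.2 ⟨(ha i).1 hi, (ha j).1 hj, hij⟩)))
  have hind := q_indep hn hp hE φ hφ
  have hWnz : ∀ f, W f ≠ 0 ↔ f ∈ (kE S).image φ := nz_iff E hEd φ hinj a S hSE ha
  have hFd : ∀ f ∈ (kE S).image φ, ¬ f.IsDiag := by
    intro f hf
    obtain ⟨e, he, rfl⟩ := Finset.mem_image.1 hf
    exact hφd e (hSE he)
  have hdiag : ∀ i, W s(i, i) = 0 := by
    intro i
    by_contra h
    exact hFd _ ((hWnz _).1 h) (by simp)
  have hcardF : ((kE S).image φ).card = (kE S).card :=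
    Finset.card_image_of_injOn (hinj.mono hSE)
  obtain ⟨S', hS', hF⟩ := graph1 (d := d) ((kE S).image φ) hFd
    (by rw [hcardF, kE_card, hS]; rfl)
    (by
      intro i
      have := W_deg (fun r S h1 h2 h3 h4 j => hind r S h1 h2 h3 h4 j) hdiag hst i
      rcases this with h | h
      · left
        intro j hj
        exact (hWnz _).2 hj (h j)
      · right
        refine h.trans (le_of_eq ?_)
        congr 1
        ext j
        simp only [Finset.mem_filter, Finset.mem_univ, true_and]
        exact hWnz _)
  have hstar := W_star (fun r S h1 h2 h3 h4 j => hind r S h1 h2 h3 h4 j) hdiag hst S' hS'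
    (by
      intro i j hij
      have := (hWnz _).1 hij
      rw [hF, mem_kE] at this
      exact this.1)
  let WP := pushW E φ (om A)
  have hWP : ∀ f, ev (WP f) = W f := fun f => map_pushW ev E φ A f
  have hstarP : ∀ k l m : Fin n, k ≠ l → k ≠ m → l ≠ m →
      WP s(k, l) * WP s(k, m) + WP s(l, m) * ∑ x, WP s(k, x) = 0 := by
    intro k l m h1 h2 h3
    by_contra hne
    apply hev _ hne
    simp only [map_add, map_mul, map_sum, hWP]
    exact hstar k l m h1 h2 h3
  let a0 : Fin n → ℚ := fun v => MvPolynomial.eval p0 (A v)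
  let W0 := pushW E φ (om a0)
  have hW0 : ∀ f, MvPolynomial.eval p0 (WP f) = W0 f :=
    fun f => map_pushW (MvPolynomial.eval p0) E φ A f
  have hstar0 : ∀ k l m : Fin n, k ≠ l → k ≠ m → l ≠ m →
      W0 s(k, l) * W0 s(k, m) + W0 s(l, m) * ∑ x, W0 s(k, x) = 0 := by
    intro k l m h1 h2 h3
    have := congrArg (MvPolynomial.eval p0) (hstarP k l m h1 h2 h3)
    simpa only [map_add, map_mul, map_sum, hW0, map_zero] using this
  have ha0 : ∀ v, a0 v ≠ 0 ↔ v ∈ S.erase o := by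
    intro v
    rw [Finset.mem_erase]
    constructor
    · intro h
      constructor
      · rintro rfl; exact h hp0
      · by_contra hv
        apply h
        simp only [a0, hA2 v hv, map_zero]
    · rintro ⟨h1, h2⟩
      exact hp1 v h2 h1
  have hsub : kE (S.erase o) ⊆ kE S := by
    intro e he
    induction e with | _ x y
    rw [mem_kE] at he ⊢
    exact ⟨Finset.mem_of_mem_erase he.1, Finset.mem_of_mem_erase he.2.1, he.2.2⟩
  have hW0nz : ∀ f, W0 f ≠ 0 ↔ f ∈ (kE (S.erase o)).image φ :=
    nz_iff E hEd φ hinj a0 (S.erase o) (hsub.trans hSE) ha0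
  have hcardF0 : ((kE (S.erase o)).image φ).card = (kE (S.erase o)).card :=
    Finset.card_image_of_injOn (hinj.mono (hsub.trans hSE))
  obtain ⟨z, hzS, hz⟩ := graph2 (d := d) S' hS' ((kE (S.erase o)).image φ)
    (by rw [← hF]; exact Finset.image_subset_image hsub)
    (by rw [hcardF0, kE_card, Finset.card_erase_of_mem ho, hS]; rfl)
    (by
      intro k l m hlm h1 h2
      have hkl : k ≠ l := by
        rintro rfl
        exact hFd _ (Finset.image_subset_image hsub h1) (by simp)
      have hkm : k ≠ m := by
        rintro rfl
        exact hFd _ (Finset.image_subset_image hsub h2) (by simp)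
      have h3 := hstar0 k l m hkl hkm hlm
      rw [← hW0nz] at h1 h2 ⊢
      intro h4
      rw [h4, zero_mul, add_zero] at h3
      exact (mul_ne_zero h1 h2) h3)
  have hdir : ∀ e ∈ kE S, z ∈ φ e → o ∈ e := by
    intro e he hze
    by_contra hoe
    obtain ⟨x, hx⟩ := hze
    apply hz x
    rw [← hx]
    apply Finset.mem_image_of_mem
    induction e with | _ u v
    rw [Sym2.mem_iff] at hoe
    rw [mem_kE] at he ⊢
    simp only [Finset.mem_erase]
    exact ⟨⟨fun h => hoe (Or.inl h.symm), he.1⟩, ⟨fun h => hoe (Or.inr h.symm), he.2.1⟩, he.2.2⟩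
  refine ⟨z, fun e he => ⟨hdir e he, fun hoe => ?_⟩⟩
  have h1 : (kE S).filter (fun e => z ∈ φ e) ⊆ (kE S).filter (fun e => o ∈ e) := by
    intro e he
    rw [Finset.mem_filter] at he ⊢
    exact ⟨he.1, hdir e he.1 he.2⟩
  have h2 : ((kE S).filter (fun e => z ∈ φ e)).card = d + 1 := by
    have h3 := kE_star S' z hzS
    rw [hS', ← hF, Finset.filter_image, Finset.card_image_of_injOn] at h3
    · exact h3
    · refine hinj.mono ?_
      intro e he
      exact hSE (Finset.mem_filter.1 he).1
  have h3 := Finset.eq_of_subset_of_card_le h1 (by rw [h2, kE_star S o ho, hS]; rfl)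
  have h4 : e ∈ (kE S).filter (fun e => o ∈ e) := Finset.mem_filter.2 ⟨he, hoe⟩
  rw [← h3] at h4
  exact (Finset.mem_filter.1 h4).2

theorem core {n d : ℕ} (hd : 2 ≤ d) (hn : d < n) {p q : Fin n → Fin d → ℝ}
    (hp : GenericConfig p) {E : Finset (Sym2 (Fin n))} (hE : Tri d E)
    (hEd : ∀ e ∈ E, ¬ e.IsDiag) (φ : Sym2 (Fin n) → Sym2 (Fin n))
    (hφ : ∀ e ∈ E, sqLenR q (φ e) = sqLenR p e)
    (S : Finset (Fin n)) (hS : S.card = d + 2) (hSE : kE S ⊆ E) :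
    ∃ σ : Fin n → Fin n, Set.InjOn σ S ∧ ∀ i ∈ S, ∀ j ∈ S, i ≠ j → φ s(i, j) = s(σ i, σ j) := by
  classical
  have h1 := core_o hd hn hp hE hEd φ hφ S hS hSE
  choose! σ hσ using h1
  have hinj : Set.InjOn σ S := by
    intro i hi j hj hij
    by_contra hne
    obtain ⟨x, hx, hxn⟩ := Finset.exists_mem_notMem_of_card_lt_card (s := {i, j}) (t := S)
      (by rw [hS]; exact Finset.card_le_two.trans_lt (by omega))
    simp only [Finset.mem_insert, Finset.mem_singleton, not_or] at hxn
    have he : s(i, x) ∈ kE S := mem_kE.2 ⟨hi, hx, Ne.symm hxn.1⟩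
    have h2 := (hσ i hi _ he).2 (by simp)
    rw [hij] at h2
    have h3 := (hσ j hj _ he).1 h2
    rw [Sym2.mem_iff] at h3
    rcases h3 with h3 | h3
    · exact hne h3.symm
    · exact hxn.2 h3.symm
  refine ⟨σ, hinj, fun i hi j hj hij => ?_⟩
  have he : s(i, j) ∈ kE S := mem_kE.2 ⟨hi, hj, hij⟩
  have h2 := (hσ i hi _ he).2 (by simp)
  have h3 := (hσ j hj _ he).2 (by simp)
  exact ((Sym2.mem_and_mem_iff (fun h => hij (hinj hi hj h))).1 ⟨h2, h3⟩)

theorem eudist_sq {d : ℕ} {x y x' y' : Fin d → ℝ} (h : eudist x y = eudist x' y') :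
    ∑ c, (x c - y c) ^ 2 = ∑ c, (x' c - y' c) ^ 2 :=
  (Real.sqrt_inj (Finset.sum_nonneg fun _ _ => sq_nonneg _)
    (Finset.sum_nonneg fun _ _ => sq_nonneg _)).1 h

theorem trilat_unique {n d : ℕ} {p : Fin n → Fin d → ℝ} (hp : GenericConfig p)
    (I : Fin (d + 1) → Fin n) (hI : Function.Injective I) (j : Fin n)
    (f : (Fin d → ℝ) → (Fin d → ℝ)) (hf : IsCongruence f) (y : Fin d → ℝ)
    (h : ∀ t, ∑ c, (y c - f (p (I t)) c) ^ 2 = ∑ c, (p j c - p (I t) c) ^ 2) : y = f (p j) := by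
  obtain ⟨x, rfl⟩ := hf.1.2 y
  congr 1
  have h1 : ∀ t, ∑ c, (x c - p (I t) c) ^ 2 = ∑ c, (p j c - p (I t) c) ^ 2 := by
    intro t
    rw [← h t]
    exact (eudist_sq (hf.2 _ _)).symm
  have hdet := gen_det hp (le_refl d) (fun t : Fin d => I t.succ)
    (hI.comp (Fin.succ_injective d)) (I 0) (fun t ht => Fin.succ_ne_zero t (hI ht))
  have hz := Matrix.eq_zero_of_mulVec_eq_zero hdet (v := fun c => x c - p j c) (by
    ext t
    simp only [Matrix.mulVec, dotProduct, Matrix.of_apply, Fin.castLE_refl, id, Pi.zero_apply]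
    have h2 := h1 0
    have h3 := h1 t.succ
    rw [← sub_eq_zero, ← Finset.sum_sub_distrib] at h2 h3
    have h4 : ∑ c, (p (I 0) c - p (I t.succ) c) * (x c - p j c) =
      (∑ c, ((x c - p (I t.succ) c) ^ 2 - (p j c - p (I t.succ) c) ^ 2) -
       ∑ c, ((x c - p (I 0) c) ^ 2 - (p j c - p (I 0) c) ^ 2)) / 2 := by
      rw [← Finset.sum_sub_distrib, Finset.sum_div]
      refine Finset.sum_congr rfl fun c _ => ?_
      ring
    rw [h4, h2, h3]; simp)
  ext c
  have := congrFun hz c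
  simp only [Pi.zero_apply] at this
  linarith

theorem exists_cong_map {n d : ℕ} {p : Fin n → Fin d → ℝ} (hp : GenericConfig p)
    (J : Fin (d + 1) → Fin n) (hJ : Function.Injective J) (y : Fin (d + 1) → Fin d → ℝ)
    (h : ∀ s t, ∑ c, (y s c - y t c) ^ 2 = ∑ c, (p (J s) c - p (J t) c) ^ 2) :
    ∃ f, IsCongruence f ∧ ∀ t, f (p (J t)) = y t := by
  let M : Matrix (Fin d) (Fin d) ℝ := Matrix.of fun t c => p (J 0) c - p (J t.succ) c
  let N : Matrix (Fin d) (Fin d) ℝ := Matrix.of fun t c => y 0 c - y t.succ c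
  have hdet : M.det ≠ 0 := gen_det hp (le_refl d) (fun t : Fin d => J t.succ)
    (hJ.comp (Fin.succ_injective d)) (J 0) (fun t ht => Fin.succ_ne_zero t (hJ ht))
  have hu : IsUnit M.det := isUnit_iff_ne_zero.2 hdet
  have hMN : N * N.transpose = M * M.transpose := by
    ext s t
    simp only [Matrix.mul_apply, Matrix.transpose_apply, M, N, Matrix.of_apply]
    have pol : ∀ a b c : Fin d → ℝ, ∑ k, (a k - b k) * (a k - c k) =
        (∑ k, (a k - b k) ^ 2 + ∑ k, (a k - c k) ^ 2 - ∑ k, (b k - c k) ^ 2) / 2 := by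
      intro a b c
      rw [← Finset.sum_add_distrib, ← Finset.sum_sub_distrib, Finset.sum_div]
      refine Finset.sum_congr rfl fun k _ => ?_
      ring
    rw [pol, pol (p (J 0)), h, h, h]
  let U := M⁻¹ * N
  have hMU : M * U = N := by
    simp only [U]
    rw [← Matrix.mul_assoc, Matrix.mul_nonsing_inv _ hu, Matrix.one_mul]
  have hUU : U * U.transpose = 1 := by
    simp only [U]
    rw [Matrix.transpose_mul, Matrix.mul_assoc, ← Matrix.mul_assoc N, hMN, Matrix.mul_assoc,
      ← Matrix.transpose_mul, Matrix.nonsing_inv_mul _ hu, Matrix.transpose_one, Matrix.mul_one,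
      Matrix.nonsing_inv_mul _ hu]
  have hUU' : U.transpose * U = 1 := mul_eq_one_comm.1 hUU
  let f : (Fin d → ℝ) → (Fin d → ℝ) := fun x => Matrix.vecMul (x - p (J 0)) U + y 0
  refine ⟨f, ⟨⟨?_, ?_⟩, ?_⟩, ?_⟩
  · intro x x' hx
    simp only [f, add_left_inj] at hx
    have := congrArg (fun v => Matrix.vecMul v U.transpose) hx
    simp only [Matrix.vecMul_vecMul, hUU, Matrix.vecMul_one, sub_left_inj] at this
    exact this
  · intro z
    refine ⟨Matrix.vecMul (z - y 0) U.transpose + p (J 0), ?_⟩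
    simp [f, Matrix.vecMul_vecMul, hUU']
  · intro x x'
    simp only [eudist]
    congr 1
    have h1 : ∀ v w : Fin d → ℝ, ∑ k, (v k - w k) ^ 2 = (v - w) ⬝ᵥ (v - w) := by
      intro v w
      simp only [dotProduct, Pi.sub_apply, sq]
    have h2 : f x - f x' = Matrix.vecMul (x - x') U := by
      simp only [f]
      rw [add_sub_add_right_eq_sub, ← Matrix.sub_vecMul, sub_sub_sub_cancel_right]
    rw [h1, h1, h2]
    nth_rewrite 2 [← Matrix.mulVec_transpose]
    rw [Matrix.dotProduct_mulVec, Matrix.vecMul_vecMul, hUU, Matrix.vecMul_one]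
  · intro t
    refine Fin.cases ?_ (fun t => ?_) t
    · simp [f]
    · have h1 : p (J t.succ) - p (J 0) = - M t := by
        ext c; simp [M]
      have h2 : Matrix.vecMul (M t) U = N t := by
        rw [← hMU]; rfl
      simp only [f]
      rw [h1, Matrix.neg_vecMul, h2]
      ext c
      simp [N]

theorem gen_injective {n d : ℕ} (hd : 1 ≤ d) {p : Fin n → Fin d → ℝ} (hp : GenericConfig p) :
    Function.Injective p := by
  intro i j hij
  by_contra hne
  have := sqLen_inj hd hp s(i, j) s(i, i) (by simpa using hne) (by simp [hij])
  rw [Sym2.eq_iff] at this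
  grind

theorem sqLen_map {n d : ℕ} {p q : Fin n → Fin d → ℝ} {f : (Fin d → ℝ) → (Fin d → ℝ)}
    (hf : IsCongruence f) (τ : Fin n → Fin n) (e : Sym2 (Fin n))
    (h : ∀ i ∈ e, q (τ i) = f (p i)) : sqLenR q (Sym2.map τ e) = sqLenR p e := by
  induction e with | _ a b
  simp only [Sym2.map_mk, sqLenR_mk]
  rw [h a (by simp), h b (by simp)]
  exact eudist_sq (hf.2 _ _)

theorem Tri.mono {n d : ℕ} {E E' : Finset (Sym2 (Fin n))} (h : Tri d E) (hs : E ⊆ E') :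
    Tri d E' := by
  refine ⟨fun i j hi hj hij => hs (h.1 i j hi hj hij), fun j hj => ?_⟩
  obtain ⟨I, hI, h2⟩ := h.2 j hj
  exact ⟨I, hI, fun t => ⟨(h2 t).1, hs (h2 t).2⟩⟩

theorem base {n d : ℕ} (hd : 2 ≤ d) (hn : d + 2 ≤ n) {p q : Fin n → Fin d → ℝ}
    (hp : GenericConfig p) {E : Finset (Sym2 (Fin n))} (hE : Tri d E)
    (hEd : ∀ e ∈ E, ¬ e.IsDiag) (φ : Sym2 (Fin n) → Sym2 (Fin n))
    (hφ : ∀ e ∈ E, sqLenR q (φ e) = sqLenR p e) :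
    ∃ f, IsCongruence f ∧ ∀ j : Fin n, j.val < d + 2 → ∃ i, q i = f (p j) := by
  classical
  let S : Finset (Fin n) := Finset.univ.map (Fin.castLEEmb hn)
  have hSm : ∀ i : Fin n, i ∈ S ↔ i.val < d + 2 := by
    intro i
    simp only [S, Finset.mem_map, Finset.mem_univ, true_and]
    constructor
    · rintro ⟨a, rfl⟩; exact a.2
    · intro h; exact ⟨⟨i.val, h⟩, rfl⟩
  have hSE : kE S ⊆ E := by
    intro e he
    induction e with | _ a b
    rw [mem_kE, hSm, hSm] at he
    exact hE.1 a b he.1 he.2.1 he.2.2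
  obtain ⟨σ, hσ, hσ2⟩ := core hd (by omega) hp hE hEd φ hφ S (by simp [S]) hSE
  have hlen : ∀ i ∈ S, ∀ j ∈ S, ∑ c, (q (σ i) c - q (σ j) c) ^ 2 = ∑ c, (p i c - p j c) ^ 2 := by
    intro i hi j hj
    by_cases hij : i = j
    · subst hij; simp
    · have h1 := hφ _ (hSE (mem_kE.2 ⟨hi, hj, hij⟩))
      rw [hσ2 i hi j hj hij] at h1
      simpa using h1
  let J : Fin (d + 1) → Fin n := Fin.castLE (by omega)
  have hJ : Function.Injective J := Fin.castLE_injective _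
  have hJS : ∀ t, J t ∈ S := fun t => (hSm _).2 (by simp [J]; omega)
  obtain ⟨f, hf, hfJ⟩ := exists_cong_map hp J hJ (fun t => q (σ (J t)))
    (fun s t => hlen _ (hJS s) _ (hJS t))
  refine ⟨f, hf, fun j hj => ⟨σ j, ?_⟩⟩
  refine trilat_unique hp J hJ j f hf _ fun t => ?_
  rw [hfJ]
  exact hlen _ ((hSm j).2 hj) _ (hJS t)

theorem step {n d : ℕ} (hd : 2 ≤ d) (hn : d + 2 ≤ n) {p q : Fin n → Fin d → ℝ}
    (hp : GenericConfig p) {E : Finset (Sym2 (Fin n))} (hE : Tri d E)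
    (hEd : ∀ e ∈ E, ¬ e.IsDiag) (φ : Sym2 (Fin n) → Sym2 (Fin n))
    (hφ : ∀ e ∈ E, sqLenR q (φ e) = sqLenR p e)
    (f : (Fin d → ℝ) → (Fin d → ℝ)) (hf : IsCongruence f) (j : Fin n) (hj : d + 2 ≤ j.val)
    (ih : ∀ i : Fin n, i.val < j.val → ∃ x, q x = f (p i)) : ∃ x, q x = f (p j) := by
  classical
  haveI : Nonempty (Fin n) := ⟨j⟩
  choose! τ hτ using ih
  let V : Finset (Fin n) := Finset.univ.filter fun i => i.val < j.val
  have hV : ∀ i, i ∈ V ↔ i.val < j.val := fun i => by simp [V]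
  let φ' : Sym2 (Fin n) → Sym2 (Fin n) := fun e => if e ∈ kE V then Sym2.map τ e else φ e
  have hφ' : ∀ e ∈ E ∪ kE V, sqLenR q (φ' e) = sqLenR p e := by
    intro e he
    by_cases hk : e ∈ kE V
    · simp only [φ', hk, if_true]
      refine sqLen_map hf τ e fun i hi => hτ i ?_
      obtain ⟨b, rfl⟩ := hi
      exact (hV _).1 (mem_kE.1 hk).1
    · simp only [φ', hk, if_false]
      exact hφ e ((Finset.mem_union.1 he).resolve_right hk)
  obtain ⟨I, hI, hI2⟩ := hE.2 j hj
  have hIj : ∀ t, I t ≠ j := fun t h => by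
    have := (hI2 t).1
    rw [h] at this
    omega
  let S : Finset (Fin n) := insert j (Finset.univ.image I)
  have hIS : ∀ t, I t ∈ S := fun t => by simp [S]
  have hjS : j ∈ S := by simp [S]
  have hSc : S.card = d + 2 := by
    rw [Finset.card_insert_of_notMem, Finset.card_image_of_injective _ hI]
    · simp
    · simp only [Finset.mem_image, Finset.mem_univ, true_and, not_exists]
      exact hIj
  have hkI : ∀ t s, t ≠ s → s(I t, I s) ∈ kE V := fun t s hts =>
    mem_kE.2 ⟨(hV _).2 (hI2 t).1, (hV _).2 (hI2 s).1, fun h => hts (hI h)⟩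
  have hSE : kE S ⊆ E ∪ kE V := by
    intro e he
    induction e with | _ a b
    rw [mem_kE] at he
    obtain ⟨ha, hb, hab⟩ := he
    simp only [S, Finset.mem_insert, Finset.mem_image, Finset.mem_univ, true_and] at ha hb
    rw [Finset.mem_union]
    rcases ha with rfl | ⟨t, rfl⟩
    · rcases hb with rfl | ⟨s, rfl⟩
      · exact absurd rfl hab
      · left; rw [Sym2.eq_swap]; exact (hI2 s).2
    · rcases hb with rfl | ⟨s, rfl⟩
      · left; exact (hI2 t).2
      · right
        exact hkI t s (fun h => hab (by rw [h]))
  obtain ⟨σ, hσ, hσ2⟩ := core hd (by omega) hp (hE.mono Finset.subset_union_left)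
    (fun e he => (Finset.mem_union.1 he).elim (hEd e) kE_nd) φ' hφ' S hSc hSE
  have hστ : ∀ t s, t ≠ s → s(τ (I t), τ (I s)) = s(σ (I t), σ (I s)) := by
    intro t s hts
    rw [← hσ2 _ (hIS t) _ (hIS s) (fun h => hts (hI h))]
    simp only [φ', hkI t s hts, if_true, Sym2.map_mk]
  have heq : ∀ t, σ (I t) = τ (I t) := by
    intro t
    obtain ⟨s, hs⟩ : ∃ s, s ∉ ({t} : Finset (Fin (d + 1))) := by
      by_contra! h
      have := Finset.card_le_card (fun x _ => h x : Finset.univ ⊆ ({t} : Finset (Fin (d + 1))))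
      simp at this
      omega
    obtain ⟨r, hr⟩ : ∃ r, r ∉ ({t, s} : Finset (Fin (d + 1))) := by
      by_contra! h
      have := (Finset.card_le_card
        (fun x _ => h x : Finset.univ ⊆ ({t, s} : Finset (Fin (d + 1))))).trans Finset.card_le_two
      simp at this
      omega
    simp only [Finset.mem_insert, Finset.mem_singleton, not_or] at hs hr
    have h1 := hστ t s (Ne.symm hs)
    have h2 := hστ t r (Ne.symm hr.1)
    have h3 : σ (I s) ≠ σ (I r) := fun h => hr.2 (hI (hσ (hIS s) (hIS r) h)).symm
    rw [Sym2.eq_iff] at h1 h2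
    rcases h1 with h1 | h1
    · exact h1.1.symm
    · rcases h2 with h2 | h2
      · exact h2.1.symm
      · exact absurd (h1.1.symm.trans h2.1) h3
  refine ⟨σ j, trilat_unique hp I hI j f hf _ fun t => ?_⟩
  have h1 := hσ2 _ hjS _ (hIS t) (hIj t).symm
  have h2 := hφ' s(j, I t) (Finset.mem_union_left _ (by rw [Sym2.eq_swap]; exact (hI2 t).2))
  rw [h1, heq] at h2
  simp only [sqLenR_mk] at h2
  rw [← h2, hτ _ (hI2 t).1]

theorem main_id {n d : ℕ} (hd : 2 ≤ d) (hn : d + 2 ≤ n) {p q : Fin n → Fin d → ℝ}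
    (hp : GenericConfig p) {E : Finset (Sym2 (Fin n))} (hE : Tri d E)
    (hEd : ∀ e ∈ E, ¬ e.IsDiag) (φ : Sym2 (Fin n) → Sym2 (Fin n))
    (hφ : ∀ e ∈ E, sqLenR q (φ e) = sqLenR p e) :
    ∃ σ : Equiv.Perm (Fin n), ∃ f : (Fin d → ℝ) → (Fin d → ℝ),
      IsCongruence f ∧ (∀ i, q (σ i) = f (p i)) ∧ ∀ e ∈ E, Sym2.map σ e = φ e := by
  obtain ⟨f, hf, hb⟩ := base hd hn hp hE hEd φ hφ
  have hall : ∀ m : ℕ, ∀ j : Fin n, j.val = m → ∃ i, q i = f (p j) := by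
    intro m
    induction m using Nat.strong_induction_on with
    | _ m ih =>
    intro j hjm
    by_cases hj : j.val < d + 2
    · exact hb j hj
    · exact step hd hn hp hE hEd φ hφ f hf j (by omega)
        (fun i hi => ih i.val (by omega) i rfl)
  choose σ hσ using fun j => hall _ j rfl
  have hinj : Function.Injective σ := by
    intro a b hab
    apply gen_injective (by omega) hp
    apply hf.1.1
    rw [← hσ, ← hσ, hab]
  let s : Equiv.Perm (Fin n) := Equiv.ofBijective σ (Finite.injective_iff_bijective.1 hinj)
  have hs : ∀ i, q (s i) = f (p i) := hσ
  refine ⟨s, f, hf, hs, fun e he => ?_⟩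
  have h1 : Sym2.map s (Sym2.map s.symm (φ e)) = φ e := by
    rw [Sym2.map_map]
    simp
  have h2 := hφ e he
  rw [← h1, sqLen_map hf s _ (fun i _ => hs i)] at h2
  rw [← h1, ← sqLen_inj (by omega) hp e _ (hEd e he) h2.symm]

theorem gen_perm {n d : ℕ} {p : Fin n → Fin d → ℝ} (hp : GenericConfig p)
    (π : Equiv.Perm (Fin n)) : GenericConfig fun i => p (π i) := by
  intro F hF
  let g : Fin n × Fin d → Fin n × Fin d := fun x => (π x.1, x.2)
  have hg : Function.Injective g := by
    rintro ⟨a, b⟩ ⟨a', b'⟩ h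
    simp only [g, Prod.mk.injEq, EmbeddingLike.apply_eq_iff_eq] at h
    rw [h.1, h.2]
  have h1 := hp (MvPolynomial.rename g F) (by
    intro h
    apply hF
    apply MvPolynomial.rename_injective g hg
    rw [h, map_zero])
  rw [MvPolynomial.aeval_rename] at h1
  exact h1

/-- Let `d ≥ 2` and let `p` be a generic configuration of
`n ≥ d+2` points in ℝ^d.  Let `v = ⟨G,p⟩²` where `G` is an edge measurement
ensemble that allows for trilateration.  If a configuration `q` of `n` points in
ℝ^d and an edge measurement ensemble `H` satisfy `v = ⟨H,q⟩²`, then there is a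
vertex relabeling `σ` of `q` under which, up to congruence, `q = p`, and
moreover `G = H`. -/
theorem unlabeled_trilateration_edge_lengths_determine_configuration
    {d n m : ℕ} (hd : 2 ≤ d) (hn : d + 2 ≤ n)
    (p q : Fin n → Fin d → ℝ) (hp : GenericConfig p)
    (G H : Fin m → Sym2 (Fin n))
    (hGinj : Function.Injective G) (hGdiag : ∀ k, ¬ (G k).IsDiag)
    (hGtri : EdgeTrilat d G)
    (hHinj : Function.Injective H) (hHdiag : ∀ k, ¬ (H k).IsDiag)
    (hv : ∀ k, sqLenR p (G k) = sqLenR q (H k)) :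
    ∃ σ : Equiv.Perm (Fin n), ∃ f : (Fin d → ℝ) → (Fin d → ℝ),
      IsCongruence f ∧ (∀ i, q (σ i) = f (p i)) ∧
      (∀ k, Sym2.map σ (G k) = H k) := by
  classical
  obtain ⟨π, h1, h2⟩ := hGtri
  let G' : Fin m → Sym2 (Fin n) := fun k => Sym2.map π.symm (G k)
  have hG' : Function.Injective G' := fun a b h =>
    hGinj (Sym2.map.injective π.symm.injective h)
  let E : Finset (Sym2 (Fin n)) := Finset.univ.image G'
  have hmem : ∀ i j k, G k = s(π i, π j) → s(i, j) ∈ E := by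
    intro i j k h
    refine Finset.mem_image.2 ⟨k, Finset.mem_univ _, ?_⟩
    simp [G', h]
  have hE : Tri d E := by
    refine ⟨fun i j hi hj hij => ?_, fun j hj => ?_⟩
    · obtain ⟨k, hk⟩ := h1 i j hi hj hij
      exact hmem i j k hk
    · obtain ⟨I, hI, h3⟩ := h2 j hj
      refine ⟨I, hI, fun t => ⟨(h3 t).1, ?_⟩⟩
      obtain ⟨k, hk⟩ := (h3 t).2
      exact hmem _ _ k hk
  have hEd : ∀ e ∈ E, ¬ e.IsDiag := by
    intro e he
    obtain ⟨k, -, rfl⟩ := Finset.mem_image.1 he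
    have := hGdiag k
    simp only [G']
    induction hk : G k with | _ a b
    rw [hk] at this
    simpa using this
  let φ : Sym2 (Fin n) → Sym2 (Fin n) := fun e =>
    if h : ∃ k, G' k = e then H h.choose else e
  have hφG : ∀ k, φ (G' k) = H k := by
    intro k
    have h : ∃ k', G' k' = G' k := ⟨k, rfl⟩
    simp only [φ, h, dif_pos]
    congr 1
    exact hG' h.choose_spec
  have hφ : ∀ e ∈ E, sqLenR q (φ e) = sqLenR (fun i => p (π i)) e := by
    intro e he
    obtain ⟨k, -, rfl⟩ := Finset.mem_image.1 he
    rw [hφG, ← hv]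
    simp only [G']
    induction G k with | _ a b
    simp
  obtain ⟨σ, f, hf, h3, h4⟩ := main_id hd hn (gen_perm hp π) hE hEd φ hφ
  refine ⟨π.symm.trans σ, f, hf, fun i => ?_, fun k => ?_⟩
  · rw [Equiv.trans_apply, h3, Equiv.apply_symm_apply]
  · rw [← hφG k, ← h4 _ (Finset.mem_image_of_mem _ (Finset.mem_univ k))]
    simp only [G', Sym2.map_map]
    rfl
end
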